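/- There exists a weak solution (v,p) of the incompressible Euler equations on ℝ×𝕋³ such that v and p are continuous, v is not identically zero, and there is a compact interval K ⊂ ℝ such that v(t,x)=0 and p(t,x)=0 for all t ∉ K. -/

import Mathlib

noncomputable section

open MeasureTheory

/-- Points of space; functions on the torus 𝕋³ = ℝ³/ℤ³ are identified with
ℤ³-periodic functions on ℝ³. -/
abbrev Spc : Type := Fin 3 → ℝ

/-- The fundamental domain [0,1)³ of the torus. -/
def Tdom : Set Spc := Set.univ.pi fun _ => Set.Ico (0 : ℝ) 1

/-- ℤ³-periodicity of a function on ℝ³. -/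
def Per {α : Type*} (f : Spc → α) : Prop :=
  ∀ (x : Spc) (k : Fin 3 → ℤ), f (fun i => x i + (k i : ℝ)) = f x

/-- Spatial partial derivative in direction `j`. -/
def pd {E : Type*} [NormedAddCommGroup E] [NormedSpace ℝ E]
    (j : Fin 3) (f : Spc → E) (x : Spc) : E :=
  fderiv ℝ f x (Pi.single j 1)

/-- Time derivative. -/
def pt {E : Type*} [NormedAddCommGroup E] [NormedSpace ℝ E]
    (f : ℝ → Spc → E) (t : ℝ) (x : Spc) : E :=
  deriv (fun s => f s x) t

/-- Smooth test function on ℝ×𝕋³: smooth, ℤ³-periodic in space and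
compactly supported in time. -/
def IsTest {E : Type*} [NormedAddCommGroup E] [NormedSpace ℝ E]
    (φ : ℝ → Spc → E) : Prop :=
  ContDiff ℝ (⊤ : ℕ∞) (fun q : ℝ × Spc => φ q.1 q.2) ∧ (∀ t, Per (φ t)) ∧
    ∃ T : ℝ, ∀ t : ℝ, T < |t| → ∀ x, φ t x = 0

/-- Weak solution of the incompressible Euler equations on ℝ×𝕋³. -/
def IsWeakEuler (v : ℝ → Spc → Spc) (p : ℝ → Spc → ℝ) : Prop :=
  (∀ φ : ℝ → Spc → Spc, IsTest φ →
    (∫ t : ℝ, ∫ x in Tdom,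
      ((∑ l, v t x l * pt (fun s y => φ s y l) t x) +
        (∑ j, ∑ l, v t x j * v t x l * pd j (fun y => φ t y l) x) +
        p t x * ∑ j, pd j (fun y => φ t y j) x)) = 0) ∧
  (∀ ψ : ℝ → Spc → ℝ, IsTest ψ →
    (∫ t : ℝ, ∫ x in Tdom, ∑ j, v t x j * pd j (ψ t) x) = 0)

/-- Hölder continuity of exponent `α`, jointly in time and space. -/
def HolderTS {E : Type*} [NormedAddCommGroup E] (α : ℝ) (f : ℝ → Spc → E) : Prop :=
  ∃ C : ℝ, ∀ (t t' : ℝ) (x x' : Spc),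
    ‖f t x - f t' x'‖ ≤ C * dist ((t, x) : ℝ × Spc) ((t', x') : ℝ × Spc) ^ α


open scoped ContDiff

/-- space-time -/
abbrev QQ : Type := ℝ × Spc

/-- Smoothness of parametric integrals over the unit interval: derivative formula. -/
theorem hasFDerivAt_param (F : QQ × ℝ → ℝ) (hF : ContDiff ℝ ∞ F) (q : QQ) :
    HasFDerivAt (fun q => ∫ s in (0:ℝ)..1, F (q, s))
      (∫ s in (0:ℝ)..1, fderiv ℝ (fun q' => F (q', s)) q) q := by
  have hd : ∀ s q, HasFDerivAt (fun q' => F (q', s)) (fderiv ℝ (fun q' => F (q', s)) q) q := by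
    intro s q
    have : ContDiff ℝ ∞ (fun q' => F (q', s)) := by fun_prop
    exact (this.differentiable (by simp)).differentiableAt.hasFDerivAt
  have heq : ∀ s q, fderiv ℝ (fun q' => F (q', s)) q
      = (fderiv ℝ F (q, s)).comp (ContinuousLinearMap.inl ℝ QQ ℝ) := by
    intro s q
    have h1 : HasFDerivAt F (fderiv ℝ F (q, s)) (q, s) :=
      (hF.differentiable (by simp)).differentiableAt.hasFDerivAt
    have h2 : HasFDerivAt (fun q' : QQ => (q', s)) (ContinuousLinearMap.inl ℝ QQ ℝ) q :=
      hasFDerivAt_prodMk_left q s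
    exact (h1.comp q h2).fderiv
  have hcont : Continuous (fun z : QQ × ℝ => fderiv ℝ (fun q' => F (q', z.2)) z.1) := by
    simp only [heq]
    have : Continuous (fderiv ℝ F) := hF.continuous_fderiv (by simp)
    fun_prop
  obtain ⟨C, hC⟩ := ((isCompact_closedBall q 1).prod (isCompact_Icc (a := (0:ℝ)) (b := 1))).exists_bound_of_continuousOn
    hcont.continuousOn
  refine (intervalIntegral.hasFDerivAt_integral_of_dominated_of_fderiv_le (𝕜 := ℝ)
    (s := Metric.ball q 1) (bound := fun _ => C)
    (F := fun q s => F (q, s)) (F' := fun q s => fderiv ℝ (fun q' => F (q', s)) q)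
    (Metric.ball_mem_nhds q one_pos) ?_ ?_ ?_ ?_ ?_ ?_)
  · refine Filter.Eventually.of_forall fun q' => ?_
    have : Continuous (fun s => F (q', s)) := hF.continuous.comp (by fun_prop)
    exact this.aestronglyMeasurable
  · have : Continuous (fun s => F (q, s)) := hF.continuous.comp (by fun_prop)
    exact this.intervalIntegrable _ _
  · have : Continuous (fun s => fderiv ℝ (fun q' => F (q', s)) q) :=
      hcont.comp (by fun_prop : Continuous (fun s : ℝ => (q, s)))
    exact this.aestronglyMeasurable
  · refine Filter.Eventually.of_forall fun s hs x hx => ?_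
    rw [Set.uIoc_of_le zero_le_one] at hs
    exact hC (x, s) ⟨Metric.ball_subset_closedBall hx, Set.Ioc_subset_Icc_self hs⟩
  · exact intervalIntegrable_const
  · exact Filter.Eventually.of_forall fun s hs x hx => hd s x

theorem contDiff_param_nat (n : ℕ) : ∀ (F : QQ × ℝ → ℝ), ContDiff ℝ ∞ F →
    ContDiff ℝ n (fun q => ∫ s in (0:ℝ)..1, F (q, s)) := by
  induction n with
  | zero =>
    intro F hF
    have : Differentiable ℝ (fun q => ∫ s in (0:ℝ)..1, F (q, s)) :=
      fun q => (hasFDerivAt_param F hF q).differentiableAt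
    simpa using (contDiff_zero (𝕜 := ℝ)).2 this.continuous
  | succ n ih =>
    intro F hF
    push_cast
    rw [contDiff_succ_iff_fderiv_apply]
    refine ⟨fun q => (hasFDerivAt_param F hF q).differentiableAt, by simp, fun y => ?_⟩
    have heq : ∀ s q, fderiv ℝ (fun q' => F (q', s)) q
        = (fderiv ℝ F (q, s)).comp (ContinuousLinearMap.inl ℝ QQ ℝ) := by
      intro s q
      have h1 : HasFDerivAt F (fderiv ℝ F (q, s)) (q, s) :=
        (hF.differentiable (by simp)).differentiableAt.hasFDerivAt
      have h2 : HasFDerivAt (fun q' : QQ => (q', s)) (ContinuousLinearMap.inl ℝ QQ ℝ) q :=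
        hasFDerivAt_prodMk_left q s
      exact (h1.comp q h2).fderiv
    have hF' : ContDiff ℝ ∞ (fun z : QQ × ℝ => fderiv ℝ F z (y, 0)) := by
      have : ContDiff ℝ ∞ (fderiv ℝ F) := hF.fderiv_right (by simp)
      fun_prop
    have := ih _ hF'
    convert this using 2 with q
    rw [(hasFDerivAt_param F hF q).fderiv]
    rw [ContinuousLinearMap.intervalIntegral_apply]
    · simp [heq]
    · have : Continuous (fun s => fderiv ℝ (fun q' => F (q', s)) q) := by
        simp only [heq]
        have : Continuous (fderiv ℝ F) := hF.continuous_fderiv (by simp)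
        fun_prop
      exact this.intervalIntegrable _ _

theorem contDiff_param (F : QQ × ℝ → ℝ) (hF : ContDiff ℝ ∞ F) :
    ContDiff ℝ ∞ (fun q => ∫ s in (0:ℝ)..1, F (q, s)) :=
  contDiff_infty.2 fun n => contDiff_param_nat n F hF

/-- The algebra of smooth spatially periodic functions on space-time. -/
def PA : Subalgebra ℝ (QQ → ℝ) where
  carrier := {f | ContDiff ℝ ∞ f ∧ ∀ t, Per (fun x => f (t, x))}
  mul_mem' := by
    rintro a b ⟨ha, ha'⟩ ⟨hb, hb'⟩
    exact ⟨ha.mul hb, fun t x k => by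
      have h1 := ha' t x k
      have h2 := hb' t x k
      simp only [Pi.mul_apply] at *
      rw [h1, h2]⟩
  add_mem' := by
    rintro a b ⟨ha, ha'⟩ ⟨hb, hb'⟩
    exact ⟨ha.add hb, fun t x k => by
      have h1 := ha' t x k
      have h2 := hb' t x k
      simp only [Pi.add_apply] at *
      rw [h1, h2]⟩
  algebraMap_mem' := fun r => ⟨contDiff_const, fun t x k => rfl⟩

/-- smooth spatially periodic functions -/
abbrev P : Type := PA

instance : CoeFun P (fun _ => QQ → ℝ) := ⟨fun f => f.1⟩

namespace P

theorem smooth (f : P) : ContDiff ℝ ∞ (fun q => f q) := f.2.1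
theorem cont (f : P) : Continuous (fun q => f q) := f.2.1.continuous
theorem per (f : P) (t : ℝ) (x : Spc) (k : Fin 3 → ℤ) :
    f (t, fun i => x i + (k i : ℝ)) = f (t, x) := f.2.2 t x k

@[simp] theorem mul_app (f g : P) (q : QQ) : (f * g) q = f q * g q := rfl
@[simp] theorem add_app (f g : P) (q : QQ) : (f + g) q = f q + g q := rfl
@[simp] theorem sub_app (f g : P) (q : QQ) : (f - g) q = f q - g q := rfl
@[simp] theorem neg_app (f : P) (q : QQ) : (-f) q = -f q := rfl
@[simp] theorem zero_app (q : QQ) : (0 : P) q = 0 := rfl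
@[simp] theorem one_app (q : QQ) : (1 : P) q = 1 := rfl
@[simp] theorem smul_app (r : ℝ) (f : P) (q : QQ) : (r • f) q = r * f q := rfl
@[simp] theorem pow_app (f : P) (n : ℕ) (q : QQ) : (f ^ n) q = f q ^ n := rfl
@[simp] theorem sum_app {ι : Type*} (s : Finset ι) (f : ι → P) (q : QQ) :
    (∑ i ∈ s, f i) q = ∑ i ∈ s, f i q := by
  have : (((∑ i ∈ s, f i : P)) : QQ → ℝ) = ∑ i ∈ s, (f i : QQ → ℝ) :=
    map_sum PA.val f s
  calc (∑ i ∈ s, f i) q = (∑ i ∈ s, (f i : QQ → ℝ)) q := congrFun this q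
    _ = _ := by simp
theorem ext' {f g : P} (h : ∀ q, f q = g q) : f = g := Subtype.ext (funext h)

theorem diffAt (f : P) (q : QQ) : DifferentiableAt ℝ (f : QQ → ℝ) q :=
  (f.smooth.differentiable (by simp)).differentiableAt

/-- directional derivative -/
def ddf (e : QQ) (f : P) : P :=
  ⟨fun q => fderiv ℝ (f : QQ → ℝ) q e, by
    refine ⟨?_, ?_⟩
    · have : ContDiff ℝ ∞ (fderiv ℝ (f : QQ → ℝ)) := f.smooth.fderiv_right (by simp)
      fun_prop
    · intro t x k
      have h : (f : QQ → ℝ) = fun q => f (q + ((0 : ℝ), fun i => (k i : ℝ))) := by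
        funext q
        obtain ⟨t, x⟩ := q
        have := f.per t x k
        simp only [Prod.mk_add_mk, add_zero]
        exact this.symm
      have h2 := fderiv_comp_add_right (𝕜 := ℝ) (f := (f : QQ → ℝ)) (x := (t, x))
        ((0 : ℝ), fun i => (k i : ℝ))
      rw [← h] at h2
      simp only [Prod.mk_add_mk, add_zero] at h2
      change fderiv ℝ (f : QQ → ℝ) (t, fun i => x i + (k i : ℝ)) e = _
      change _ = fderiv ℝ (f : QQ → ℝ) (t, x) e
      rw [h2]
      rfl⟩

theorem ddf_app (e : QQ) (f : P) (q : QQ) : ddf e f q = fderiv ℝ (f : QQ → ℝ) q e := rfl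

/-- directional derivative as a derivation -/
def dd (e : QQ) : Derivation ℝ P P :=
  Derivation.mk'
    { toFun := ddf e
      map_add' := fun f g => ext' fun q => by
        have := fderiv_add (f.diffAt q) (g.diffAt q)
        simp only [add_app, ddf_app]
        change fderiv ℝ ((f : QQ → ℝ) + (g : QQ → ℝ)) q e = _
        rw [this]; rfl
      map_smul' := fun r f => ext' fun q => by
        have := fderiv_const_smul (f.diffAt q) r
        simp only [smul_app, ddf_app, RingHom.id_apply]
        change fderiv ℝ (r • (f : QQ → ℝ)) q e = _
        rw [this]; rfl }
    (fun f g => ext' fun q => by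
        have := fderiv_mul (f.diffAt q) (g.diffAt q)
        simp only [add_app, smul_eq_mul, mul_app, LinearMap.coe_mk, AddHom.coe_mk, ddf_app]
        change fderiv ℝ ((f : QQ → ℝ) * (g : QQ → ℝ)) q e = _
        rw [this]; simp)

theorem dd_app (e : QQ) (f : P) (q : QQ) : dd e f q = fderiv ℝ (f : QQ → ℝ) q e := rfl

theorem dd_comm (e e' : QQ) (f : P) : dd e (dd e' f) = dd e' (dd e f) := by
  refine ext' fun q => ?_
  have hs : IsSymmSndFDerivAt ℝ (f : QQ → ℝ) q :=
    f.smooth.contDiffAt.isSymmSndFDerivAt (by simp; exact WithTop.coe_le_coe.2 le_top)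
  have hd : ∀ y, HasFDerivAt (fderiv ℝ (f : QQ → ℝ)) (fderiv ℝ (fderiv ℝ (f : QQ → ℝ)) y) y := by
    have : ContDiff ℝ ∞ (fderiv ℝ (f : QQ → ℝ)) := f.smooth.fderiv_right (by simp)
    exact fun y => (this.differentiable (by simp)).differentiableAt.hasFDerivAt
  have key : ∀ a b : QQ, dd a (dd b f) q = fderiv ℝ (fderiv ℝ (f : QQ → ℝ)) q a b := by
    intro a b
    rw [dd_app]
    have h1 : HasFDerivAt ((dd b f : P) : QQ → ℝ)
      ((ContinuousLinearMap.apply ℝ ℝ b).comp (fderiv ℝ (fderiv ℝ (f : QQ → ℝ)) q)) q :=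
      (ContinuousLinearMap.apply ℝ ℝ b).hasFDerivAt.comp q (hd q)
    rw [h1.fderiv]
    rfl
  rw [key, key]
  exact hs e e'

/-- time derivative -/
def Dt : Derivation ℝ P P := dd (1, 0)
/-- space derivative -/
def Dx (j : Fin 3) : Derivation ℝ P P := dd (0, Pi.single j 1)

/-- time support in `[-T, T]` -/
def Supp (T : ℝ) (f : P) : Prop := ∀ q : QQ, T < |q.1| → f q = 0

theorem Supp.zero (T : ℝ) : Supp T 0 := fun _ _ => rfl
theorem Supp.add {T : ℝ} {f g : P} (hf : Supp T f) (hg : Supp T g) : Supp T (f + g) :=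
  fun q hq => by simp [hf q hq, hg q hq]
theorem Supp.sub {T : ℝ} {f g : P} (hf : Supp T f) (hg : Supp T g) : Supp T (f - g) :=
  fun q hq => by simp [hf q hq, hg q hq]
theorem Supp.neg {T : ℝ} {f : P} (hf : Supp T f) : Supp T (-f) :=
  fun q hq => by simp [hf q hq]
theorem Supp.mul_left {T : ℝ} {f : P} (g : P) (hf : Supp T f) : Supp T (g * f) :=
  fun q hq => by simp [hf q hq]
theorem Supp.mul_right {T : ℝ} {f : P} (g : P) (hf : Supp T f) : Supp T (f * g) :=
  fun q hq => by simp [hf q hq]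
theorem Supp.smul {T : ℝ} {f : P} (r : ℝ) (hf : Supp T f) : Supp T (r • f) :=
  fun q hq => by simp [hf q hq]
theorem Supp.sum {T : ℝ} {ι : Type*} {s : Finset ι} {f : ι → P} (hf : ∀ i, Supp T (f i)) :
    Supp T (∑ i ∈ s, f i) :=
  fun q hq => by
    rw [sum_app]
    exact Finset.sum_eq_zero fun i _ => hf i q hq
theorem Supp.mono {T T' : ℝ} {f : P} (hf : Supp T f) (h : T ≤ T') : Supp T' f :=
  fun q hq => hf q (lt_of_le_of_lt h hq)
theorem Supp.dd {T : ℝ} {f : P} (e : QQ) (hf : Supp T f) : Supp T (dd e f) := by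
  intro q hq
  rw [dd_app]
  have hopen : IsOpen {q : QQ | T < |q.1|} := isOpen_lt continuous_const (by fun_prop)
  have : (f : QQ → ℝ) =ᶠ[nhds q] fun _ => 0 :=
    Filter.eventually_of_mem (hopen.mem_nhds hq) fun y hy => hf y hy
  rw [this.fderiv_eq]
  simp
theorem Supp.Dx {T : ℝ} {f : P} (j : Fin 3) (hf : Supp T f) : Supp T (Dx j f) := hf.dd _
theorem Supp.Dt {T : ℝ} {f : P} (hf : Supp T f) : Supp T (Dt f) := hf.dd _

theorem bounded_of_supp {T : ℝ} {f : P} (hf : Supp T f) : ∃ C, 0 ≤ C ∧ ∀ q, |f q| ≤ C := by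
  obtain ⟨C, hC⟩ := ((isCompact_Icc (a := -T) (b := T)).prod
    (isCompact_univ_pi fun _ : Fin 3 => isCompact_Icc (a := (0:ℝ)) (b := 1))).exists_bound_of_continuousOn
    f.cont.continuousOn
  refine ⟨max C 0, le_max_right _ _, fun q => ?_⟩
  by_cases hq : T < |q.1|
  · rw [hf q hq]; simp
  · have h1 := f.per q.1 (fun i => Int.fract (q.2 i)) (fun i => ⌊q.2 i⌋)
    simp only [Int.fract_add_floor] at h1
    have : f q = f (q.1, fun i => Int.fract (q.2 i)) := h1
    rw [this]
    refine le_trans (hC _ ⟨?_, ?_⟩) (le_max_left _ _)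
    · rw [not_lt, abs_le] at hq
      exact hq
    · intro i _
      exact ⟨Int.fract_nonneg _, (Int.fract_lt_one _).le⟩

end P

namespace P

theorem fract_eq (f : P) (q : QQ) : f q = f (q.1, fun i => Int.fract (q.2 i)) := by
  have h1 := f.per q.1 (fun i => Int.fract (q.2 i)) (fun i => ⌊q.2 i⌋)
  simp only [Int.fract_add_floor] at h1
  exact h1

theorem cont_slice (f : P) (t : ℝ) : Continuous (fun x : Spc => f (t, x)) :=
  f.cont.comp (by fun_prop)

theorem Tdom_ae : Tdom =ᵐ[volume] Set.Icc (0 : Spc) 1 :=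
  Measure.univ_pi_Ico_ae_eq_Icc (f := fun _ : Fin 3 => (0:ℝ)) (g := fun _ => 1)

theorem hasFDerivAt_slice (f : P) (t : ℝ) (x : Spc) :
    HasFDerivAt (fun x : Spc => f (t, x))
      ((fderiv ℝ (f : QQ → ℝ) (t, x)).comp (ContinuousLinearMap.inr ℝ ℝ Spc)) x :=
  (f.diffAt (t, x)).hasFDerivAt.comp x (hasFDerivAt_prodMk_right t x)

theorem integral_div (G : Fin 3 → P) (t : ℝ) :
    ∫ x in Tdom, ∑ j, Dx j (G j) (t, x) = 0 := by
  rw [setIntegral_congr_set Tdom_ae]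
  have key := integral_divergence_of_hasFDerivAt_off_countable' (n := 2) (E := ℝ)
    (0 : Fin 3 → ℝ) 1 (by intro i; simp) (fun j x => G j (t, x))
    (fun j x => (fderiv ℝ (G j : QQ → ℝ) (t, x)).comp (ContinuousLinearMap.inr ℝ ℝ Spc))
    ∅ Set.countable_empty (fun i => ((G i).cont_slice t).continuousOn)
    (fun x _ i => (G i).hasFDerivAt_slice t x)
    (by
      have : Continuous (fun x : Spc => ∑ j, Dx j (G j) (t, x)) :=
        continuous_finsetSum _ fun j _ => (Dx j (G j)).cont_slice t
      exact this.continuousOn.integrableOn_compact isCompact_Icc)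
  refine Eq.trans ?_ (key.trans ?_)
  · rfl
  · refine Finset.sum_eq_zero fun i _ => ?_
    rw [sub_eq_zero]
    congr 1
    funext y
    have := (G i).per t (Fin.insertNth i (0:ℝ) y) (Pi.single i 1)
    simp only [Pi.zero_apply, Pi.one_apply]
    rw [← this]
    refine congrArg (G i : QQ → ℝ) (Prod.ext rfl (funext fun k => ?_))
    rcases Fin.eq_self_or_eq_succAbove i k with rfl | ⟨l, rfl⟩
    · simp
    · simp [Pi.single_apply, Fin.succAbove_ne]

theorem dd_eq_of_line {f : P} {q e : QQ} {d : ℝ}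
    (h : HasDerivAt (fun r : ℝ => f (q + r • e)) d 0) : dd e f q = d := by
  have h1 : HasLineDerivAt ℝ (f : QQ → ℝ) d q e := h
  rw [dd_app, ← (f.diffAt q).lineDeriv_eq_fderiv]
  exact h1.lineDeriv

/-- replace the `j`-th space coordinate -/
def up (j : Fin 3) (q : QQ) (s : ℝ) : QQ := (q.1, fun i => if i = j then s else q.2 i)

theorem up_smooth (j : Fin 3) : ContDiff ℝ ∞ (fun z : QQ × ℝ => up j z.1 z.2) := by
  unfold up
  refine ContDiff.prodMk (by fun_prop) (contDiff_pi.2 fun i => ?_)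
  by_cases h : i = j
  · simp only [h, if_true]; fun_prop
  · simp only [h, if_false]; fun_prop

theorem up_cont (j : Fin 3) (q : QQ) : Continuous (fun s : ℝ => up j q s) :=
  (up_smooth j).continuous.comp (by fun_prop : Continuous (fun s : ℝ => (q, s)))

theorem up_up (j : Fin 3) (q : QQ) (r s : ℝ) : up j (up j q r) s = up j q s := by
  unfold up
  refine Prod.ext rfl (funext fun i => ?_)
  by_cases h : i = j <;> simp [h]

theorem up_comm {j k : Fin 3} (h : j ≠ k) (q : QQ) (r s : ℝ) :
    up j (up k q r) s = up k (up j q s) r := by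
  unfold up
  refine Prod.ext rfl (funext fun i => ?_)
  by_cases h1 : i = j
  · subst h1; simp [h]
  · by_cases h2 : i = k
    · subst h2; simp [h1]
    · simp [h1, h2]

theorem up_self (j : Fin 3) (q : QQ) : up j q (q.2 j) = q := by
  unfold up
  refine Prod.ext rfl (funext fun i => ?_)
  by_cases h : i = j <;> simp [h]

theorem up_line (j : Fin 3) (q : QQ) (r : ℝ) :
    q + r • ((0 : ℝ), (Pi.single j 1 : Spc)) = up j q (q.2 j + r) := by
  unfold up
  refine Prod.ext (by simp) (funext fun i => ?_)
  by_cases h : i = j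
  · subst h; simp
  · simp [h]

/-- independence of the `k`-th coordinate -/
def Inv (k : Fin 3) (f : P) : Prop := ∀ q s, f (up k q s) = f q

theorem Inv.sub {k : Fin 3} {f g : P} (hf : Inv k f) (hg : Inv k g) : Inv k (f - g) :=
  fun q s => by simp [hf q s, hg q s]

theorem Inv.Dx_eq {k : Fin 3} {f : P} (hf : Inv k f) : Dx k f = 0 := by
  refine ext' fun q => dd_eq_of_line ?_
  simp only [up_line, hf q]
  exact hasDerivAt_const _ _

theorem up_per (f : P) (j : Fin 3) (t : ℝ) (x : Spc) (k : Fin 3 → ℤ) (s : ℝ) :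
    f (up j (t, fun i => x i + (k i : ℝ)) s) = f (up j (t, x) s) := by
  have := f.per t (up j (t, x) s).2 (fun i => if i = j then 0 else k i)
  refine Eq.trans ?_ this
  refine congrArg (f : QQ → ℝ) ?_
  unfold up
  refine Prod.ext rfl (funext fun i => ?_)
  by_cases h : i = j <;> simp [h]

theorem up_periodic (f : P) (j : Fin 3) (q : QQ) :
    Function.Periodic (fun s => f (up j q s)) 1 := by
  intro s
  have := f.per (up j q s).1 (up j q s).2 (fun i => if i = j then 1 else 0)
  refine Eq.trans ?_ this
  refine congrArg (f : QQ → ℝ) ?_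
  unfold up
  refine Prod.ext rfl (funext fun i => ?_)
  by_cases h : i = j <;> simp [h]

theorem exists_avg (j : Fin 3) (f : P) : ∃ a : P, ∀ q, a q = ∫ s in (0:ℝ)..1, f (up j q s) := by
  refine ⟨⟨fun q => ∫ s in (0:ℝ)..1, f (up j q s), ?_, ?_⟩, fun q => rfl⟩
  · exact contDiff_param (fun z => f (up j z.1 z.2)) (f.smooth.comp (up_smooth j))
  · intro t x k
    simp only [up_per]

theorem exists_prim (j : Fin 3) (f : P) (hf : ∀ q, ∫ s in (0:ℝ)..1, f (up j q s) = 0) :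
    ∃ g : P, Dx j g = f ∧ ∀ q, g q = ∫ s in (0:ℝ)..(q.2 j), f (up j q s) := by
  have hc : ∀ q, Continuous fun s => f (up j q s) := fun q => f.cont.comp (up_cont j q)
  have hIntv : ∀ q a b, IntervalIntegrable (fun s => f (up j q s)) volume a b :=
    fun q a b => (hc q).intervalIntegrable a b
  let g : P := ⟨fun q => ∫ s in (0:ℝ)..(q.2 j), f (up j q s), by
    refine ⟨?_, ?_⟩
    · have h1 : (fun q : QQ => ∫ s in (0:ℝ)..(q.2 j), f (up j q s))
          = fun q : QQ => ∫ s in (0:ℝ)..1, q.2 j * f (up j q (s * q.2 j)) := by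
        funext q
        have := intervalIntegral.smul_integral_comp_mul_right (a := 0) (b := 1)
          (fun s => f (up j q s)) (q.2 j)
        rw [intervalIntegral.integral_const_mul]
        simp only [zero_mul, one_mul, smul_eq_mul] at this
        exact this.symm
      rw [h1]
      refine contDiff_param (fun z : QQ × ℝ => z.1.2 j * f (up j z.1 (z.2 * z.1.2 j))) ?_
      have hA : ContDiff ℝ ∞ (fun z : QQ × ℝ => z.1.2 j) := by fun_prop
      have hB : ContDiff ℝ ∞ (fun z : QQ × ℝ => (z.1, z.2 * z.1.2 j)) := by fun_prop
      exact hA.mul (f.smooth.comp ((up_smooth j).comp hB))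
    · intro t x k
      simp only [up_per]
      have h1 : (∫ s in (x j)..(x j + (k j : ℝ)), f (up j (t, x) s)) = 0 := by
        have := (f.up_periodic j (t, x)).intervalIntegral_add_zsmul_eq (k j) (x j)
          (fun a b => hIntv _ a b)
        simp only [zsmul_eq_mul, mul_one] at this
        rw [this, (f.up_periodic j (t, x)).intervalIntegral_add_eq (x j) 0]
        simp [hf]
      have h2 := intervalIntegral.integral_add_adjacent_intervals
        (hIntv (t, x) 0 (x j)) (hIntv (t, x) (x j) (x j + (k j : ℝ)))
      rw [h1, add_zero] at h2
      exact h2.symm⟩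
  refine ⟨g, ?_, fun q => rfl⟩
  refine ext' fun q => dd_eq_of_line ?_
  have h1 : ∀ r : ℝ, g (q + r • ((0 : ℝ), (Pi.single j 1 : Spc)))
      = ∫ s in (0:ℝ)..(q.2 j + r), f (up j q s) := by
    intro r
    rw [up_line]
    change (∫ s in (0:ℝ)..((up j q (q.2 j + r)).2 j), f (up j (up j q (q.2 j + r)) s)) = _
    simp only [up_up]
    congr 1
    simp [up]
  simp only [h1]
  have h2 : HasDerivAt (fun y => ∫ s in (0:ℝ)..y, f (up j q s)) (f (up j q (q.2 j + 0)))
      (q.2 j + 0) :=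
    intervalIntegral.integral_hasDerivAt_right (hIntv _ _ _)
      (hc q).stronglyMeasurable.stronglyMeasurableAtFilter (hc q).continuousAt
  have h3 := h2.comp_const_add (q.2 j) 0
  rw [add_zero, up_self] at h3
  exact h3

theorem avg_step (j : Fin 3) (f : P) : ∃ a g : P, Dx j g = f - a ∧ Inv j a ∧
    (∀ k, k ≠ j → Inv k f → Inv k a ∧ Inv k g) ∧
    (∀ T, Supp T f → Supp T a ∧ Supp T g) ∧
    (∀ C, (∀ q, |f q| ≤ C) → (∀ q, |a q| ≤ C) ∧ ∀ q, |g q| ≤ 2 * C) := by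
  obtain ⟨a, ha⟩ := exists_avg j f
  have hinv : Inv j a := fun q s => by rw [ha, ha]; simp only [up_up]
  have hc : ∀ (f : P) q, Continuous fun s => f (up j q s) := fun f q => f.cont.comp (up_cont j q)
  obtain ⟨g, hg, hg'⟩ := exists_prim j (f - a) (by
    intro q
    simp only [sub_app, hinv q]
    rw [intervalIntegral.integral_sub ((hc f q).intervalIntegrable _ _) (by simp), ← ha q]
    simp)
  refine ⟨a, g, hg, hinv, ?_, ?_, ?_⟩
  · intro k hk hf
    have h1 : Inv k a := by
      intro q s
      rw [ha, ha]
      congr 1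
      funext r
      rw [up_comm (Ne.symm hk), hf]
    refine ⟨h1, ?_⟩
    intro q s
    rw [hg', hg']
    have h2 : (up k q s).2 j = q.2 j := by simp [up, Ne.symm hk]
    rw [h2]
    congr 1
    funext r
    rw [up_comm (Ne.symm hk), hf.sub h1]
  · intro T hf
    have h1 : Supp T a := by
      intro q hq
      rw [ha]
      have : ∀ s, f (up j q s) = 0 := fun s => hf _ hq
      simp [this]
    refine ⟨h1, ?_⟩
    intro q hq
    rw [hg']
    have : ∀ s, (f - a) (up j q s) = 0 := fun s => (hf.sub h1) _ hq
    simp [this]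
  · intro C hf
    have h1 : ∀ q, |a q| ≤ C := by
      intro q
      rw [ha]
      have := intervalIntegral.norm_integral_le_of_norm_le_const (a := 0) (b := 1)
        (f := fun s => f (up j q s)) (C := C) (fun s _ => hf _)
      simpa using this
    refine ⟨h1, fun q => ?_⟩
    rw [fract_eq g q, hg']
    have h2 : ∀ q, |(f - a) q| ≤ 2 * C := by
      intro q
      have := abs_sub (f q) (a q)
      have := hf q
      have := h1 q
      simp only [sub_app]
      linarith
    have := intervalIntegral.norm_integral_le_of_norm_le_const (a := 0) (b := Int.fract (q.2 j))
        (f := fun s => (f - a) (up j (q.1, fun i => Int.fract (q.2 i)) s)) (C := 2 * C)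
        (fun s _ => h2 _)
    refine le_trans this ?_
    have h3 := Int.fract_nonneg (q.2 j)
    have h4 := (Int.fract_lt_one (q.2 j)).le
    have h5 : 0 ≤ 2 * C := le_trans (abs_nonneg _) (h2 q)
    rw [sub_zero, abs_of_nonneg h3]
    nlinarith

/-- Scalar anti-divergence, starting with direction `i`. -/
theorem scalar_antidiv (i : Fin 3) (G : Fin 3 → P) (T ε : ℝ)
    (hT : ∀ j, Supp T (G j)) (hb : ∀ q, |(∑ j, Dx j (G j)) q| ≤ ε) :
    ∃ g : Fin 3 → P, ∑ j, Dx j (g j) = ∑ j, Dx j (G j) ∧ (∀ j, j ≠ i → Dx i (g j) = 0) ∧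
      (∀ j, Supp T (g j)) ∧ ∀ j q, |g j q| ≤ 2 * ε := by
  have hfs : Supp T (∑ j, Dx j (G j)) := Supp.sum fun j => (hT j).Dx j
  set f : P := ∑ j, Dx j (G j) with hfdef
  have hij : i + 1 ≠ i := by fin_cases i <;> decide
  have hik : i + 2 ≠ i := by fin_cases i <;> decide
  have hjk : i + 2 ≠ i + 1 := by fin_cases i <;> decide
  obtain ⟨a1, g1, e1, inv1, pres1, s1, b1⟩ := avg_step i f
  obtain ⟨a2, g2, e2, inv2, pres2, s2, b2⟩ := avg_step (i + 1) a1
  obtain ⟨a3, g3, e3, inv3, pres3, s3, b3⟩ := avg_step (i + 2) a2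
  have i2 := pres2 i hij.symm inv1
  have i3 := pres3 i hik.symm i2.1
  have i3' := pres3 (i + 1) hjk.symm inv2
  have S1 := s1 T hfs
  have S2 := s2 T S1.1
  have S3 := s3 T S2.1
  have B1 := b1 ε hb
  have B2 := b2 ε B1.1
  have B3 := b3 ε B2.1
  let g : Fin 3 → P := fun j => if j = i then g1 else if j = i + 1 then g2 else g3
  have hsum : ∑ j, Dx j (g j) = Dx i g1 + Dx (i+1) g2 + Dx (i+2) g3 := by
    rw [Fin.sum_univ_three]
    fin_cases i <;> simp [g] <;> abel
  have ha3 : a3 = 0 := by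
    have hc : ∀ t x, a3 (t, x) = a3 (t, 0) := by
      intro t x
      rw [← i3.1 (t, x) 0, ← i3'.1 (up i (t, x) 0) 0, ← inv3 _ 0]
      refine congrArg (a3 : QQ → ℝ) ?_
      unfold up
      refine Prod.ext rfl (funext fun k => ?_)
      simp only [Pi.zero_apply]
      fin_cases i <;> fin_cases k <;> simp
    have hdiv : a3 = ∑ j, Dx j (G j - g j) := by
      simp only [map_sub, Finset.sum_sub_distrib, hsum, e1, e2, e3, ← hfdef]
      abel
    refine ext' fun q => ?_
    obtain ⟨t, x⟩ := q
    have := integral_div (fun j => G j - g j) t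
    have h2 : ∀ x, ∑ j, Dx j (G j - g j) (t, x) = a3 (t, 0) := by
      intro x
      rw [← hc t x, hdiv, sum_app]
    simp only [h2] at this
    rw [setIntegral_congr_set Tdom_ae] at this
    simp [Measure.real, Real.volume_Icc_pi] at this
    rw [hc, this]; rfl
  refine ⟨g, ?_, ?_, ?_, ?_⟩
  · rw [hsum, e1, e2, e3, ha3]; abel
  · intro j hj
    by_cases h : j = i + 1
    · simp only [g, hj, h, hij, if_true, if_false]; exact i2.2.Dx_eq
    · simp only [g, hj, h, if_false]; exact i3.2.Dx_eq
  · intro j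
    simp only [g]; split_ifs
    exacts [S1.2, S2.2, S3.2]
  · intro j
    simp only [g]; split_ifs
    exacts [B1.2, B2.2, B3.2]

theorem antidiv (G : Fin 3 → Fin 3 → P) (T ε : ℝ)
    (hT : ∀ i j, Supp T (G i j)) (hb : ∀ i q, |(∑ j, Dx j (G i j)) q| ≤ ε) :
    ∃ N : Fin 3 → Fin 3 → P, (∀ i j, N i j = N j i) ∧
      (∀ i, ∑ j, Dx j (N i j) = ∑ j, Dx j (G i j)) ∧
      (∀ i j, Supp T (N i j)) ∧ ∀ i j q, |N i j q| ≤ 4 * ε := by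
  choose g hg1 hg2 hg3 hg4 using fun i => scalar_antidiv i (G i) T ε (hT i) (hb i)
  have hε : 0 ≤ ε := le_trans (abs_nonneg _) (hb 0 0)
  refine ⟨fun i j => if i = j then g i i else g i j + g j i, ?_, ?_, ?_, ?_⟩
  · intro i j
    by_cases h : i = j
    · subst h; rfl
    · simp only [h, Ne.symm h, if_false]; abel
  · intro i
    rw [← hg1]
    refine Finset.sum_congr rfl fun j _ => ?_
    by_cases h : i = j
    · subst h; simp
    · simp only [h, if_false, map_add, hg2 j i h, add_zero]
  · intro i j
    dsimp only
    split_ifs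
    · exact hg3 i i
    · exact (hg3 i j).add (hg3 j i)
  · intro i j q
    dsimp only
    split_ifs
    · have := hg4 i i q
      linarith
    · have h1 := hg4 i j q
      have h2 := hg4 j i q
      have := abs_add_le (g i j q) (g j i q)
      simp only [add_app]
      linarith

end P

section abstractWave

variable {A : Type*} [CommRing A] [Algebra ℝ A]

/-- The algebraic identity behind the addition of one high frequency shear wave. -/
theorem wave_identity (D : Fin 3 → Derivation ℝ A A) (Dt : Derivation ℝ A A)
    (v n u z b b2 w : Fin 3 → A) (S M M' : Fin 3 → Fin 3 → A)
    (nt h k l hf c s c2 s2 : A)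
    (hkl : l * k = 1) (hhf : 2 * hf = 1)
    (hDl : ∀ j, D j l = 0) (hDtl : Dt l = 0) (hDhf : ∀ j, D j hf = 0)
    (hDs : ∀ j, D j s = k * c * n j) (hDts : Dt s = k * c * nt)
    (hDc : ∀ j, D j c = -(k * s * n j)) (hDtc : Dt c = -(k * s * nt))
    (hDs2 : ∀ j, D j s2 = 2 * k * c2 * n j) (hDc2 : ∀ j, D j c2 = -(2 * k * s2 * n j))
    (hcc : c * c = hf * (1 + c2))
    (hw : ∀ i, w i = u i * c + l * (z i * s))
    (hun : ∑ j, u j * n j = 0) (hdv : ∑ j, D j (v j) = 0) (hdw : ∑ j, D j (w j) = 0)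
    (hh : h = nt + ∑ j, v j * n j)
    (hS : ∀ i, ∑ j, S i j * n j = h * u i)
    (hb : ∀ i, b i = Dt (u i) + ∑ j, v j * D j (u i) + h * z i + ∑ j, u j * D j (v i)
      - ∑ j, D j (S i j))
    (hM : ∀ i, ∑ j, M i j * n j = b i)
    (hM' : ∀ i, ∑ j, M' i j * n j = hf * ∑ j, D j (u i * u j))
    (hb2 : ∀ i, b2 i = Dt (z i) + ∑ j, v j * D j (z i) + ∑ j, z j * D j (v i)) (i : Fin 3) :
    Dt (w i) + ∑ j, D j (v i * w j + w i * v j + w i * w j)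
      = ∑ j, D j (hf * (u i * u j) + S i j * c + l * (s * c * (u i * z j + z i * u j)
          + l * (s * s * (z i * z j)) + M i j * s + hf * (M' i j * s2)))
        + l * (s * (b2 i - ∑ j, D j (M i j)) - hf * (s2 * ∑ j, D j (M' i j))) := by
  have lb : ∀ (d : Derivation ℝ A A) (x y : A), d (x * y) = x * d y + y * d x := by
    intro d x y; simp [Derivation.leibniz]
  have E1 : ∑ j, D j (S i j * c) = c * ∑ j, D j (S i j) - k * s * (h * u i) := by
    rw [← hS i]
    simp only [lb, hDc, Fin.sum_univ_three]; ring
  have E2 : ∑ j, D j (l * (M i j * s)) = l * s * ∑ j, D j (M i j) + c * b i := by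
    rw [← hM i]
    simp only [lb, hDs, hDl, Fin.sum_univ_three]
    linear_combination (c * (M i 0 * n 0 + M i 1 * n 1 + M i 2 * n 2)) * hkl
  have E3 : ∑ j, D j (l * (hf * (M' i j * s2))) = l * hf * s2 * ∑ j, D j (M' i j)
      + c2 * (hf * ∑ j, D j (u i * u j)) := by
    rw [← hM' i]
    simp only [lb, hDs2, hDl, hDhf, Fin.sum_univ_three]
    linear_combination (2 * hf * c2 * (M' i 0 * n 0 + M' i 1 * n 1 + M' i 2 * n 2)) * hkl
      + (c2 * (M' i 0 * n 0 + M' i 1 * n 1 + M' i 2 * n 2)) * hhf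
  have E4 : ∑ j, D j (hf * (u i * u j) * c2) = c2 * (hf * ∑ j, D j (u i * u j)) := by
    simp only [lb, hDc2, hDhf, Fin.sum_univ_three] at hun ⊢
    linear_combination (-(2 * k * s2 * hf * u i)) * hun
  have E5 : ∀ j, D j (w i) = D j (u i) * c - u i * (k * s * n j) + l * s * D j (z i)
      + z i * c * n j := by
    intro j
    rw [hw]
    simp only [map_add, lb, hDc, hDs, hDl]
    linear_combination (z i * c * n j) * hkl
  have E6 : Dt (w i) = Dt (u i) * c - u i * (k * s * nt) + l * s * Dt (z i)
      + z i * c * nt := by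
    rw [hw]
    simp only [map_add, lb, hDtc, hDts, hDtl]
    linear_combination (z i * c * nt) * hkl
  have E7 : ∀ j, w i * w j = hf * (u i * u j) + hf * (u i * u j) * c2
      + (l * (s * c * (u i * z j + z i * u j)) + l * (l * (s * s * (z i * z j)))) := by
    intro j
    rw [hw, hw]
    linear_combination (u i * u j) * hcc
  have E8 : ∑ j, D j (v i * w j) = ∑ j, w j * D j (v i) := by
    simp only [lb, Fin.sum_univ_three] at hdw ⊢
    linear_combination (v i) * hdw
  have E9 : ∑ j, D j (w i * v j) = ∑ j, v j * D j (w i) := by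
    simp only [lb, Fin.sum_univ_three] at hdv ⊢
    linear_combination (w i) * hdv
  have L1 : ∑ j, D j (v i * w j + w i * v j + w i * w j)
      = ∑ j, w j * D j (v i) + ∑ j, v j * D j (w i) + ∑ j, D j (hf * (u i * u j))
        + c2 * (hf * ∑ j, D j (u i * u j))
        + ∑ j, D j (l * (s * c * (u i * z j + z i * u j)) + l * (l * (s * s * (z i * z j)))) := by
    rw [← E4, ← E8, ← E9]
    simp only [E7]
    simp only [map_add, Finset.sum_add_distrib]
    ring
  have L2 : ∑ j, D j (hf * (u i * u j) + S i j * c + l * (s * c * (u i * z j + z i * u j)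
          + l * (s * s * (z i * z j)) + M i j * s + hf * (M' i j * s2)))
      = ∑ j, D j (hf * (u i * u j)) + ∑ j, D j (S i j * c)
        + ∑ j, D j (l * (s * c * (u i * z j + z i * u j)) + l * (l * (s * s * (z i * z j))))
        + ∑ j, D j (l * (M i j * s)) + ∑ j, D j (l * (hf * (M' i j * s2))) := by
    simp only [← Finset.sum_add_distrib, ← map_add]
    refine Finset.sum_congr rfl fun j _ => ?_
    congr 1
    ring
  rw [L1, L2, E1, E2, E3, E6, hb, hb2]
  simp only [E5]
  simp only [hw, Fin.sum_univ_three] at hh ⊢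
  rw [hh]
  ring

theorem div_antisymm (D : Fin 3 → Derivation ℝ A A) (hcomm : ∀ i j f, D i (D j f) = D j (D i f))
    (F : Fin 3 → Fin 3 → A) (hF : ∀ i j, F i j = -F j i) :
    ∑ i, D i (∑ j, D j (F i j)) = 0 := by
  have h0 : ∀ i, D i (D i (F i i)) = 0 := by
    intro i
    have h1 : F i i + F i i = 0 := by
      have := hF i i
      linear_combination this
    have h2 : (2 : ℝ) • F i i = 0 := by rw [two_smul]; exact h1
    have h3 : F i i = 0 := by
      have : ((2:ℝ)⁻¹ * 2) • F i i = 0 := by rw [mul_smul, h2, smul_zero]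
      simpa using this
    simp [h3]
  simp only [Fin.sum_univ_three, map_add, h0]
  rw [hF 1 0, hF 2 0, hF 2 1, hcomm 1 0, hcomm 2 0, hcomm 2 1]
  simp only [map_neg]
  ring

end abstractWave

namespace P

/-- Smooth Euler-Reynolds subsolution (without pressure). -/
structure Sub (T : ℝ) (v : Fin 3 → P) (R : Fin 3 → Fin 3 → P) : Prop where
  sv : ∀ i, Supp T (v i)
  sR : ∀ i j, Supp T (R i j)
  symm : ∀ i j, R i j = R j i
  div : ∑ j, Dx j (v j) = 0
  mom : ∀ i, Dt (v i) + ∑ j, Dx j (v i * v j) = ∑ j, Dx j (R i j)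

/-- constants -/
def con (r : ℝ) : P := algebraMap ℝ P r
@[simp] theorem con_app (r : ℝ) (q : QQ) : con r q = r := rfl
@[simp] theorem dd_con (e : QQ) (r : ℝ) : dd e (con r) = 0 := Derivation.map_algebraMap _ _

/-- periodicity of the phase -/
theorem phase_per (m : Fin 3) (ϑ : P) (N : ℕ) (t : ℝ) (x : Spc) (k : Fin 3 → ℤ) :
    2 * Real.pi * N * ((x m + (k m : ℝ)) + ϑ (t, fun i => x i + (k i : ℝ)))
      = 2 * Real.pi * N * (x m + ϑ (t, x)) + ((N * k m : ℤ) : ℝ) * (2 * Real.pi) := by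
  rw [ϑ.per]; push_cast; ring

/-- `cos (2 π N (x_m + ϑ))` -/
def cosP (m : Fin 3) (ϑ : P) (N : ℕ) : P :=
  ⟨fun q => Real.cos (2 * Real.pi * N * (q.2 m + ϑ q)), by
    refine ⟨?_, fun t x k => ?_⟩
    · have := ϑ.smooth
      fun_prop
    · simp only [phase_per]
      rw [Real.cos_add_int_mul_two_pi]⟩

/-- `sin (2 π N (x_m + ϑ))` -/
def sinP (m : Fin 3) (ϑ : P) (N : ℕ) : P :=
  ⟨fun q => Real.sin (2 * Real.pi * N * (q.2 m + ϑ q)), by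
    refine ⟨?_, fun t x k => ?_⟩
    · have := ϑ.smooth
      fun_prop
    · simp only [phase_per]
      rw [Real.sin_add_int_mul_two_pi]⟩

theorem cosP_app (m : Fin 3) (ϑ : P) (N : ℕ) (q : QQ) :
    cosP m ϑ N q = Real.cos (2 * Real.pi * N * (q.2 m + ϑ q)) := rfl
theorem sinP_app (m : Fin 3) (ϑ : P) (N : ℕ) (q : QQ) :
    sinP m ϑ N q = Real.sin (2 * Real.pi * N * (q.2 m + ϑ q)) := rfl

theorem cosP_le (m : Fin 3) (ϑ : P) (N : ℕ) (q : QQ) : |cosP m ϑ N q| ≤ 1 :=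
  Real.abs_cos_le_one _
theorem sinP_le (m : Fin 3) (ϑ : P) (N : ℕ) (q : QQ) : |sinP m ϑ N q| ≤ 1 :=
  Real.abs_sin_le_one _

theorem phase_deriv (m : Fin 3) (ϑ : P) (N : ℕ) (q : QQ) :
    HasFDerivAt (fun q : QQ => 2 * Real.pi * N * (q.2 m + ϑ q))
      ((2 * Real.pi * N : ℝ) • (((ContinuousLinearMap.proj m).comp (ContinuousLinearMap.snd ℝ ℝ Spc))
        + fderiv ℝ (ϑ : QQ → ℝ) q)) q := by
  have h1 : HasFDerivAt (fun q : QQ => q.2 m)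
      ((ContinuousLinearMap.proj m).comp (ContinuousLinearMap.snd ℝ ℝ Spc)) q :=
    ((ContinuousLinearMap.proj (R := ℝ) (φ := fun _ : Fin 3 => ℝ) m).comp
      (ContinuousLinearMap.snd ℝ ℝ Spc)).hasFDerivAt
  exact (h1.add (ϑ.diffAt q).hasFDerivAt).const_mul _

theorem dd_sinP (m : Fin 3) (ϑ : P) (N : ℕ) (e : QQ) :
    dd e (sinP m ϑ N) = con (2 * Real.pi * N) * cosP m ϑ N * (con (e.2 m) + dd e ϑ) := by
  refine ext' fun q => ?_
  rw [dd_app]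
  have h : HasFDerivAt (sinP m ϑ N : QQ → ℝ) _ q := (phase_deriv m ϑ N q).sin
  rw [h.fderiv]
  simp [cosP_app, dd_app]
  ring

theorem dd_cosP (m : Fin 3) (ϑ : P) (N : ℕ) (e : QQ) :
    dd e (cosP m ϑ N) = -(con (2 * Real.pi * N) * sinP m ϑ N * (con (e.2 m) + dd e ϑ)) := by
  refine ext' fun q => ?_
  rw [dd_app]
  have h : HasFDerivAt (cosP m ϑ N : QQ → ℝ) _ q := (phase_deriv m ϑ N q).cos
  rw [h.fderiv]
  simp [sinP_app, dd_app]
  ring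

theorem bounded_fam {ι : Type*} [Fintype ι] {T : ℝ} (f : ι → P) (hf : ∀ i, Supp T (f i)) :
    ∃ C, 0 ≤ C ∧ ∀ i q, |f i q| ≤ C := by
  choose C hC hb using fun i => bounded_of_supp (hf i)
  refine ⟨∑ i, C i, Finset.sum_nonneg fun i _ => hC i, fun i q => (hb i q).trans ?_⟩
  exact Finset.single_le_sum (fun i _ => hC i) (Finset.mem_univ i)

/-- parametrix -/
def Mf (n : Fin 3 → P) (ν : P) (b : Fin 3 → P) (i j : Fin 3) : P :=
  ν * (b i * n j + n i * b j) - ν * ν * (∑ k, b k * n k) * (n i * n j)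

theorem Mf_n (n : Fin 3 → P) (ν : P) (b : Fin 3 → P) (hν : ν * ∑ j, n j * n j = 1) (i : Fin 3) :
    ∑ j, Mf n ν b i j * n j = b i := by
  simp only [Mf, Fin.sum_univ_three] at *
  linear_combination (b i - ν * (b 0 * n 0 + b 1 * n 1 + b 2 * n 2) * n i) * hν

theorem Mf_symm (n : Fin 3 → P) (ν : P) (b : Fin 3 → P) (i j : Fin 3) :
    Mf n ν b i j = Mf n ν b j i := by
  unfold Mf; ring

theorem Mf_supp {T : ℝ} (n : Fin 3 → P) (ν : P) {b : Fin 3 → P} (hb : ∀ i, Supp T (b i))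
    (i j : Fin 3) : Supp T (Mf n ν b i j) := by
  unfold Mf
  refine Supp.sub (Supp.mul_left _ (Supp.add (Supp.mul_right _ (hb i)) (Supp.mul_left _ (hb j))))
    (Supp.mul_right _ (Supp.mul_left _ (Supp.sum fun k => Supp.mul_right _ (hb k))))

/-- Addition of one wave. -/
theorem wave_step {T T' : ℝ} {v : Fin 3 → P} {R : Fin 3 → Fin 3 → P} (hsub : Sub T v R)
    (hT : T ≤ T') (m : Fin 3) (ϑ : P) (E : Fin 3 → Fin 3 → P) (hE : ∀ i j, E i j = -E j i)
    (hES : ∀ i j, Supp T' (E i j)) (n u : Fin 3 → P)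
    (hn : ∀ j, n j = con (if j = m then 1 else 0) + Dx j ϑ)
    (hu : ∀ i, u i = ∑ j, E i j * n j) (ν : P) (hν : ν * ∑ j, n j * n j = 1)
    (h : P) (hh : h = Dt ϑ + ∑ j, v j * n j) (κ : ℝ)
    (hκ : ∀ i j q, |(h * (u i * n j + n i * u j) * ν) q| ≤ κ) (ε : ℝ) (hε : 0 < ε) :
    ∃ (v' : Fin 3 → P) (R' : Fin 3 → Fin 3 → P), Sub T' v' R' ∧
      (∃ c : QQ → ℝ, (∀ q, |c q| ≤ 1) ∧ ∀ i q, |v' i q - v i q - u i q * c q| ≤ ε) ∧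
      ∀ i j q, |R' i j q - R i j q - u i q * u j q / 2| ≤ κ + ε := by
  have hsv : ∀ i, Supp T' (v i) := fun i => (hsub.sv i).mono hT
  let hf : P := con (1 / 2)
  let z : Fin 3 → P := fun i => ∑ j, Dx j (E i j)
  let S : Fin 3 → Fin 3 → P := fun i j => h * (u i * n j + n i * u j) * ν
  let b : Fin 3 → P := fun i => Dt (u i) + ∑ j, v j * Dx j (u i) + h * z i
    + ∑ j, u j * Dx j (v i) - ∑ j, Dx j (S i j)
  let b1 : Fin 3 → P := fun i => hf * ∑ j, Dx j (u i * u j)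
  let b2 : Fin 3 → P := fun i => Dt (z i) + ∑ j, v j * Dx j (z i) + ∑ j, z j * Dx j (v i)
  let M : Fin 3 → Fin 3 → P := Mf n ν b
  let M' : Fin 3 → Fin 3 → P := Mf n ν b1
  have su : ∀ i, Supp T' (u i) := fun i => by
    rw [hu]; exact Supp.sum fun j => Supp.mul_right _ (hES i j)
  have sz : ∀ i, Supp T' (z i) := fun i => Supp.sum fun j => (hES i j).Dx j
  have sS : ∀ i j, Supp T' (S i j) := fun i j =>
    Supp.mul_right _ (Supp.mul_left _ ((Supp.mul_right _ (su i)).add (Supp.mul_left _ (su j))))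
  have sb : ∀ i, Supp T' (b i) := fun i =>
    ((((su i).Dt.add (Supp.sum fun j => Supp.mul_left _ ((su i).Dx j))).add
      (Supp.mul_left _ (sz i))).add (Supp.sum fun j => Supp.mul_right _ (su j))).sub
      (Supp.sum fun j => (sS i j).Dx j)
  have sb1 : ∀ i, Supp T' (b1 i) := fun i =>
    Supp.mul_left _ (Supp.sum fun j => (Supp.mul_right _ (su i)).Dx j)
  have sb2 : ∀ i, Supp T' (b2 i) := fun i =>
    ((sz i).Dt.add (Supp.sum fun j => Supp.mul_left _ ((sz i).Dx j))).add
      (Supp.sum fun j => Supp.mul_right _ (sz j))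
  have sM : ∀ i j, Supp T' (M i j) := Mf_supp n ν sb
  have sM' : ∀ i j, Supp T' (M' i j) := Mf_supp n ν sb1
  obtain ⟨C1, hC1, B1⟩ := bounded_fam z sz
  obtain ⟨C2, hC2, B2⟩ := bounded_fam (fun p : Fin 3 × Fin 3 => u p.1 * z p.2 + z p.1 * u p.2)
    (fun p => (Supp.mul_right _ (su p.1)).add (Supp.mul_left _ (su p.2)))
  obtain ⟨C3, hC3, B3⟩ := bounded_fam (fun p : Fin 3 × Fin 3 => z p.1 * z p.2)
    (fun p => (Supp.mul_right _ (sz p.1)))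
  obtain ⟨C4, hC4, B4⟩ := bounded_fam (fun p : Fin 3 × Fin 3 => M p.1 p.2) (fun p => sM p.1 p.2)
  obtain ⟨C5, hC5, B5⟩ := bounded_fam (fun p : Fin 3 × Fin 3 => M' p.1 p.2) (fun p => sM' p.1 p.2)
  obtain ⟨C6, hC6, B6⟩ := bounded_fam (fun i => b2 i - ∑ j, Dx j (M i j))
    (fun i => (sb2 i).sub (Supp.sum fun j => (sM i j).Dx j))
  obtain ⟨C7, hC7, B7⟩ := bounded_fam (fun i => ∑ j, Dx j (M' i j))
    (fun i => (Supp.sum fun j => (sM' i j).Dx j))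
  set C0 : ℝ := C1 + C2 + C3 + C4 + C5 + 4 * C6 + 4 * C7 with hC0
  obtain ⟨N, hN⟩ := exists_nat_ge (C0 / ε + 1)
  have hC0n : 0 ≤ C0 := by positivity
  have hN1 : (1 : ℝ) ≤ N := le_trans (by have := div_nonneg hC0n hε.le; linarith) hN
  set om : ℝ := 2 * Real.pi * N with hom
  have homN : (N : ℝ) ≤ om := by
    have := Real.pi_gt_three
    nlinarith
  have hom1 : 1 ≤ om := hN1.trans homN
  have hom0 : 0 < om := by linarith
  have hεom : C0 ≤ ε * om := by
    have h1 : C0 / ε ≤ om := by linarith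
    rwa [div_le_iff₀ hε, mul_comm] at h1
  let l : P := con om⁻¹
  let k : P := con om
  have hkl : l * k = 1 := ext' fun q => by simp [l, k, hom0.ne']
  have hhf : 2 * hf = 1 := ext' fun q => by
    change (2 : ℝ) * (1 / 2) = 1
    norm_num
  let c := cosP m ϑ N
  let s := sinP m ϑ N
  let c2 := cosP m ϑ (2 * N)
  let s2 := sinP m ϑ (2 * N)
  have hkk : con (2 * Real.pi * (2 * N : ℕ)) = 2 * k := ext' fun q => by
    change (2 * Real.pi * (2 * N : ℕ)) = 2 * om
    rw [hom]; push_cast; ring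
  have hn' : ∀ j, con (((0 : ℝ), (Pi.single j 1 : Spc)).2 m) + dd (0, Pi.single j 1) ϑ = n j := by
    intro j
    rw [hn]
    congr 2
    simp only [Pi.single_apply, eq_comm]
  have hnt' : con (((1 : ℝ), (0 : Spc)).2 m) + dd (1, 0) ϑ = Dt ϑ := by
    refine ext' fun q => ?_
    simp [Dt]
  have hDs : ∀ j, Dx j s = k * c * n j := fun j => by
    simp only [Dx, s, dd_sinP, hn']; rfl
  have hDc : ∀ j, Dx j c = -(k * s * n j) := fun j => by
    simp only [Dx, c, dd_cosP, hn']; rfl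
  have hDts : Dt s = k * c * Dt ϑ := by
    rw [← hnt']; simp only [Dt, s, dd_sinP]; rfl
  have hDtc : Dt c = -(k * s * Dt ϑ) := by
    rw [← hnt']; simp only [Dt, c, dd_cosP]; rfl
  have hDs2 : ∀ j, Dx j s2 = 2 * k * c2 * n j := fun j => by
    simp only [Dx, s2, dd_sinP, hn', hkk]; rfl
  have hDc2 : ∀ j, Dx j c2 = -(2 * k * s2 * n j) := fun j => by
    simp only [Dx, c2, dd_cosP, hn', hkk]; rfl
  have hcc : c * c = hf * (1 + c2) := ext' fun q => by
    simp only [mul_app, add_app, one_app, c, c2, hf, con_app, cosP_app]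
    have := Real.cos_two_mul (2 * Real.pi * N * (q.2 m + ϑ q))
    have e : 2 * Real.pi * (2 * N : ℕ) * (q.2 m + ϑ q)
        = 2 * (2 * Real.pi * N * (q.2 m + ϑ q)) := by push_cast; ring
    rw [e, this]; ring
  have hDl : ∀ j, Dx j l = 0 := fun j => dd_con _ _
  have hDtl : Dt l = 0 := dd_con _ _
  have hDhf : ∀ j, Dx j hf = 0 := fun j => dd_con _ _
  have lb : ∀ (d : Derivation ℝ P P) (x y : P), d (x * y) = x * d y + y * d x := by
    intro d x y; simp [Derivation.leibniz]
  let w : Fin 3 → P := fun i => ∑ j, Dx j (l * (E i j * s))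
  have hw : ∀ i, w i = u i * c + l * (z i * s) := by
    intro i
    simp only [w, hu, z, lb, hDl, hDs, Fin.sum_univ_three]
    linear_combination (c * (E i 0 * n 0 + E i 1 * n 1 + E i 2 * n 2)) * hkl
  have hdw : ∑ j, Dx j (w j) = 0 := by
    refine div_antisymm Dx (fun i j f => dd_comm _ _ f) (fun i j => l * (E i j * s)) ?_
    intro i j
    rw [hE i j]; ring
  have hun : ∑ j, u j * n j = 0 := by
    have hd : ∀ i, E i i = 0 := fun i => ext' fun q => by
      have := congrArg (fun f : P => f q) (hE i i)
      simp only [neg_app] at this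
      simp only [zero_app]
      linarith
    simp only [hu, Fin.sum_univ_three, hd]
    rw [hE 1 0, hE 2 0, hE 2 1]
    ring
  have hSn : ∀ i, ∑ j, S i j * n j = h * u i := by
    intro i
    simp only [S, Fin.sum_univ_three] at hun hν ⊢
    linear_combination (h * u i) * hν + (h * n i * ν) * hun
  let Y : Fin 3 → Fin 3 → P := fun i j => s * c * (u i * z j + z i * u j)
          + l * (s * s * (z i * z j)) + M i j * s + hf * (M' i j * s2)
  let r : Fin 3 → P := fun i => s * (b2 i - ∑ j, Dx j (M i j)) - hf * (s2 * ∑ j, Dx j (M' i j))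
  have key : ∀ i, Dt (w i) + ∑ j, Dx j (v i * w j + w i * v j + w i * w j)
      = ∑ j, Dx j (hf * (u i * u j) + S i j * c + l * Y i j) + l * r i := fun i =>
    wave_identity Dx Dt v n u z b b2 w S M M' (Dt ϑ) h k l hf c s c2 s2 hkl hhf hDl hDtl hDhf
      hDs hDts hDc hDtc hDs2 hDc2 hcc hw hun hsub.div hdw hh hSn (fun i => rfl)
      (Mf_n n ν b hν) (Mf_n n ν b1 hν) (fun i => rfl) i
  have sw : ∀ i, Supp T' (w i) := fun i =>
    Supp.sum fun j => (Supp.mul_left _ (Supp.mul_right _ (hES i j))).Dx j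
  have sY : ∀ i j, Supp T' (Y i j) := fun i j =>
    (((Supp.mul_left _ ((Supp.mul_right _ (su i)).add (Supp.mul_left _ (su j)))).add
      (Supp.mul_left _ (Supp.mul_left _ (Supp.mul_right _ (sz i))))).add
      (Supp.mul_right _ (sM i j))).add (Supp.mul_left _ (Supp.mul_right _ (sM' i j)))
  let G : Fin 3 → Fin 3 → P := fun i j => Dt (l * (E i j * s))
    + (v i * w j + w i * v j + w i * w j) - (hf * (u i * u j) + S i j * c + l * Y i j)
  have sX : ∀ i j, Supp T' (hf * (u i * u j) + S i j * c + l * Y i j) := fun i j =>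
    ((Supp.mul_left _ (Supp.mul_right _ (su i))).add (Supp.mul_right _ (sS i j))).add
      (Supp.mul_left _ (sY i j))
  have sG : ∀ i j, Supp T' (G i j) := fun i j =>
    ((Supp.mul_left _ (Supp.mul_right _ (hES i j))).Dt.add
      (((Supp.mul_left _ (sw j)).add (Supp.mul_right _ (sw i))).add
        (Supp.mul_right _ (sw i)))).sub (sX i j)
  have hG : ∀ i, ∑ j, Dx j (G i j) = l * r i := by
    intro i
    have h1 : ∑ j, Dx j (G i j) = Dt (w i) + ∑ j, Dx j (v i * w j + w i * v j + w i * w j)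
        - ∑ j, Dx j (hf * (u i * u j) + S i j * c + l * Y i j) := by
      have h2 : Dt (w i) = ∑ j, Dx j (Dt (l * (E i j * s))) := by
        simp only [w, map_sum]
        exact Finset.sum_congr rfl fun j _ => dd_comm _ _ _
      rw [h2, ← Finset.sum_add_distrib, ← Finset.sum_sub_distrib]
      refine Finset.sum_congr rfl fun j _ => ?_
      simp only [G, map_add, map_sub]
    rw [h1, key]; ring
  have ac : ∀ q, |c q| ≤ 1 := cosP_le _ _ _
  have as : ∀ q, |s q| ≤ 1 := sinP_le _ _ _
  have as2 : ∀ q, |s2 q| ≤ 1 := sinP_le _ _ _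
  have mle : ∀ {x y C : ℝ}, |x| ≤ 1 → |y| ≤ C → |x * y| ≤ C := by
    intro x y C hx hy
    rw [abs_mul]
    nlinarith [abs_nonneg x, abs_nonneg y]
  have hinv : om⁻¹ ≤ 1 := inv_le_one_of_one_le₀ hom1
  have hinv0 : 0 < om⁻¹ := by positivity
  have br : ∀ i q, |(∑ j, Dx j (G i j)) q| ≤ om⁻¹ * (C6 + C7) := by
    intro i q
    rw [hG]
    simp only [mul_app, l, con_app, r, sub_app, hf]
    rw [abs_mul, abs_of_pos hinv0]
    refine mul_le_mul_of_nonneg_left ?_ hinv0.le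
    refine (abs_sub _ _).trans (add_le_add (mle (as q) (B6 i q)) ?_)
    refine mle (by norm_num) (mle (as2 q) (B7 i q))
  obtain ⟨Nn, symN, divN, sN, bN⟩ := antidiv G T' _ sG br
  refine ⟨fun i => v i + w i, fun i j => R i j + (hf * (u i * u j) + S i j * c + l * Y i j) + Nn i j,
    ⟨?_, ?_, ?_, ?_, ?_⟩, ⟨fun q => c q, ac, ?_⟩, ?_⟩
  · exact fun i => (hsv i).add (sw i)
  · exact fun i j => ((((hsub.sR i j).mono hT)).add (sX i j)).add (sN i j)
  · intro i j
    have e1 : S i j = S j i := by simp only [S]; ring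
    have e2 : Y i j = Y j i := by
      simp only [Y, M, M']
      rw [Mf_symm n ν b i j, Mf_symm n ν b1 i j]; ring
    rw [e1, e2, hsub.symm i j, symN i j]; ring
  · simp only [map_add, Finset.sum_add_distrib, hsub.div, hdw, add_zero]
  · intro i
    have e1 : ∀ j, (v i + w i) * (v j + w j) = v i * v j + (v i * w j + w i * v j + w i * w j) :=
      fun j => by ring
    have k1 := key i
    have k2 := hsub.mom i
    have k3 := divN i
    rw [hG] at k3
    simp only [e1]
    simp only [map_add (Dx _) (v i * v _), map_add (Dx _) (R i _ + _), map_add (Dx _) (R i _),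
      Finset.sum_add_distrib (f := fun j => Dx j (v i * v j)), map_add Dt]
    rw [Finset.sum_add_distrib, Finset.sum_add_distrib, k3]
    linear_combination k1 + k2
  · intro i q
    have e1 : (v i + w i) q - v i q - u i q * c q = om⁻¹ * (s q * z i q) := by
      rw [hw]; simp only [add_app, mul_app, l, con_app]; ring
    simp only
    rw [e1, abs_mul, abs_of_pos hinv0, inv_mul_le_iff₀ hom0]
    refine (mle (as q) (B1 i q)).trans ?_
    linarith
  · intro i j q
    have e1 : (R i j + (hf * (u i * u j) + S i j * c + l * Y i j) + Nn i j) q - R i j q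
        - u i q * u j q / 2 = c q * S i j q + (om⁻¹ * Y i j q + Nn i j q) := by
      simp only [add_app, mul_app, l, hf, con_app]; ring
    have bY : |Y i j q| ≤ C2 + C3 + C4 + C5 := by
      simp only [Y, add_app, mul_app, l, con_app, hf]
      refine (abs_add_le _ _).trans (add_le_add ((abs_add_le _ _).trans (add_le_add
        ((abs_add_le _ _).trans (add_le_add ?_ ?_)) ?_)) ?_)
      · exact mle (mle (as q) (ac q)) (B2 (i, j) q)
      · exact mle (by rw [abs_of_pos hinv0]; exact hinv)
          (mle (mle (as q) (as q)) (B3 (i, j) q))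
      · rw [mul_comm]; exact mle (as q) (B4 (i, j) q)
      · refine mle (by norm_num) ?_
        rw [mul_comm]; exact mle (as2 q) (B5 (i, j) q)
    simp only
    rw [e1]
    refine (abs_add_le _ _).trans (add_le_add (mle (ac q) (hκ i j q)) ?_)
    have b3 := bN i j q
    have b4 : |om⁻¹ * Y i j q| ≤ om⁻¹ * (C2 + C3 + C4 + C5) := by
      rw [abs_mul, abs_of_pos hinv0]
      exact mul_le_mul_of_nonneg_left bY hinv0.le
    have b5 : om⁻¹ * C0 ≤ ε := by
      rw [inv_mul_le_iff₀ hom0, mul_comm]; linarith [mul_comm ε om]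
    have b6 : om⁻¹ * C0 = om⁻¹ * C1 + om⁻¹ * (C2 + C3 + C4 + C5) + 4 * (om⁻¹ * (C6 + C7)) := by
      rw [hC0]; ring
    have b7 : 0 ≤ om⁻¹ * C1 := by positivity
    have := abs_add_le (om⁻¹ * Y i j q) (Nn i j q)
    linarith

end P

namespace P

/-- functions of time as elements of `P` -/
def tf (f : ℝ → ℝ) (hf : ContDiff ℝ ∞ f) : P :=
  ⟨fun q => f q.1, by fun_prop, fun t x k => rfl⟩

theorem tf_app (f : ℝ → ℝ) (hf : ContDiff ℝ ∞ f) (q : QQ) : tf f hf q = f q.1 := rfl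

theorem tf_deriv (f : ℝ → ℝ) (hf : ContDiff ℝ ∞ f) (q : QQ) :
    HasFDerivAt (tf f hf : QQ → ℝ) (deriv f q.1 • ContinuousLinearMap.fst ℝ ℝ Spc) q := by
  have h : HasDerivAt f (deriv f q.1) q.1 :=
    (hf.differentiable (by simp)).differentiableAt.hasDerivAt
  exact h.comp_hasFDerivAt q (ContinuousLinearMap.fst ℝ ℝ Spc).hasFDerivAt

theorem Dx_tf (f : ℝ → ℝ) (hf : ContDiff ℝ ∞ f) (j : Fin 3) : Dx j (tf f hf) = 0 :=
  ext' fun q => by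
    rw [Dx, dd_app, (tf_deriv f hf q).fderiv]; simp

theorem Dt_tf (f : ℝ → ℝ) (hf : ContDiff ℝ ∞ f) (q : QQ) : Dt (tf f hf) q = deriv f q.1 := by
  rw [Dt, dd_app, (tf_deriv f hf q).fderiv]; simp

theorem exists_inv (f : P) (hf : ∀ q, f q ≠ 0) : ∃ ν : P, ν * f = 1 :=
  ⟨⟨fun q => (f q)⁻¹, f.smooth.inv hf, fun t x k => by
    change (f (t, fun i => x i + (k i : ℝ)))⁻¹ = (f (t, x))⁻¹
    rw [f.per]⟩, ext' fun q => inv_mul_cancel₀ (hf q)⟩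

theorem exists_sqrt (f : P) (hf : ∀ q, 0 < f q) : ∃ b : P, ∀ q, b q = Real.sqrt (f q) :=
  ⟨⟨fun q => Real.sqrt (f q), f.smooth.sqrt (fun q => (hf q).ne'), fun t x k => by
    change Real.sqrt (f (t, fun i => x i + (k i : ℝ))) = Real.sqrt (f (t, x))
    rw [f.per]⟩, fun q => rfl⟩

/-- smooth positive function agreeing with `1 + c` for `c ≥ -1/2` -/
def psi (c : ℝ) : ℝ :=
  Real.smoothTransition (4 * c + 3) * (1 + c) + (1 - Real.smoothTransition (4 * c + 3))

theorem psi_smooth : ContDiff ℝ ∞ psi := by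
  have : ContDiff ℝ ∞ Real.smoothTransition := Real.smoothTransition.contDiff
  unfold psi
  fun_prop

theorem psi_eq {c : ℝ} (hc : -1 / 2 ≤ c) : psi c = 1 + c := by
  unfold psi
  rw [Real.smoothTransition.one_of_one_le (by linarith)]; ring

theorem psi_pos (c : ℝ) : 0 < psi c := by
  unfold psi
  rcases le_or_gt (4 * c + 3) 0 with h | h
  · rw [Real.smoothTransition.zero_of_nonpos h]; norm_num
  · have h1 := Real.smoothTransition.nonneg (4 * c + 3)
    have h2 := Real.smoothTransition.le_one (4 * c + 3)
    have h3 : -3 / 4 < c := by linarith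
    nlinarith

/-- smooth sawtooth -/
def saw (s : ℝ) : ℝ :=
  Real.arctan (Real.sin (2 * Real.pi * s) / psi (Real.cos (2 * Real.pi * s))) / Real.pi

theorem saw_smooth : ContDiff ℝ ∞ saw := by
  unfold saw
  have h1 : ContDiff ℝ ∞ (fun s : ℝ => psi (Real.cos (2 * Real.pi * s))) :=
    psi_smooth.comp (by fun_prop)
  have h2 : ContDiff ℝ ∞ (fun s : ℝ => Real.sin (2 * Real.pi * s) / psi (Real.cos (2 * Real.pi * s))) :=
    ContDiff.div (by fun_prop) h1 (fun s => (psi_pos _).ne')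
  exact (Real.contDiff_arctan.comp h2).div_const _

theorem saw_le (s : ℝ) : |saw s| ≤ 1 := by
  unfold saw
  rw [abs_div, abs_of_pos Real.pi_pos, div_le_one Real.pi_pos, abs_le]
  have h1 := Real.neg_pi_div_two_lt_arctan (Real.sin (2 * Real.pi * s) / psi (Real.cos (2 * Real.pi * s)))
  have h2 := Real.arctan_lt_pi_div_two (Real.sin (2 * Real.pi * s) / psi (Real.cos (2 * Real.pi * s)))
  have := Real.pi_pos
  constructor <;> linarith

theorem saw_deriv {s : ℝ} (hs : -1 / 2 < Real.cos (2 * Real.pi * s)) : deriv saw s = 1 := by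
  have ho : IsOpen {s : ℝ | -1 / 2 < Real.cos (2 * Real.pi * s)} :=
    isOpen_lt continuous_const (by fun_prop)
  have he : saw =ᶠ[nhds s] fun s => Real.arctan (Real.sin (2 * Real.pi * s) /
      (1 + Real.cos (2 * Real.pi * s))) / Real.pi :=
    Filter.eventually_of_mem (ho.mem_nhds hs) fun y hy => by
      unfold saw; rw [psi_eq (le_of_lt hy)]
  rw [he.deriv_eq]
  have hl : HasDerivAt (fun s : ℝ => 2 * Real.pi * s) (2 * Real.pi) s := by
    simpa using (hasDerivAt_id s).const_mul (2 * Real.pi)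
  have hc : 1 + Real.cos (2 * Real.pi * s) ≠ 0 := by linarith
  have h := (((hl.sin.div (hl.cos.const_add 1) hc).arctan).div_const Real.pi).deriv
  simp only [Pi.div_apply] at h
  refine Eq.trans ?_ (h.trans ?_)
  · rfl
  · set c := Real.cos (2 * Real.pi * s)
    set z := Real.sin (2 * Real.pi * s)
    have hz : z ^ 2 = 1 - c ^ 2 := by
      have := Real.sin_sq_add_cos_sq (2 * Real.pi * s); simp only [z, c]; linarith
    have hp := Real.pi_ne_zero
    have hc' : (1 + c) ^ 2 + z ^ 2 ≠ 0 := by rw [hz]; intro h0; apply hc; linarith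
    have e1 : c * (2 * Real.pi) * (1 + c) - z * (-z * (2 * Real.pi)) = 2 * Real.pi * (1 + c) := by
      linear_combination 2 * Real.pi * hz
    have e2 : 1 + (z / (1 + c)) ^ 2 = 2 / (1 + c) := by
      field_simp; linear_combination hz
    rw [e1, e2]
    field_simp

theorem exists_time (τ : ℝ) (hτ : 0 < τ) : ∃ α β g g' : P, (∀ j, Dx j g = 0) ∧
    (∀ j, Dx j g' = 0) ∧ (∀ q, α q * α q + β q * β q = 1) ∧ (∀ q, |g q| ≤ τ) ∧ (∀ q, |g' q| ≤ τ) ∧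
    α * (1 - Dt g) = 0 ∧ β * (1 - Dt g') = 0 := by
  have hS : ContDiff ℝ ∞ Real.smoothTransition := Real.smoothTransition.contDiff
  let S : ℝ → ℝ := fun s => Real.pi / 2 * Real.smoothTransition (1 / 2 + Real.cos (2 * Real.pi * (s / τ)))
  have hSs : ContDiff ℝ ∞ S := by
    refine contDiff_const.mul (hS.comp ?_)
    fun_prop
  have hg : ∀ a : ℝ, ContDiff ℝ ∞ (fun t : ℝ => τ * saw (t / τ + a)) := fun a =>
    contDiff_const.mul (saw_smooth.comp (by fun_prop))
  have hgd : ∀ a t : ℝ, deriv (fun t : ℝ => τ * saw (t / τ + a)) t = deriv saw (t / τ + a) := by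
    intro a t
    have h1 : HasDerivAt saw (deriv saw (t / τ + a)) (t / τ + a) :=
      (saw_smooth.differentiable (by simp)).differentiableAt.hasDerivAt
    have h2 : HasDerivAt (fun t : ℝ => t / τ + a) (1 / τ) t :=
      ((hasDerivAt_id t).div_const τ).add_const a
    have h3 := ((h1.comp t h2).const_mul τ).deriv
    refine Eq.trans ?_ (h3.trans ?_)
    · rfl
    · field_simp
  refine ⟨tf (fun t => Real.sin (S t)) hSs.sin, tf (fun t => Real.cos (S t)) hSs.cos,
    tf _ (hg 0), tf _ (hg (1 / 2)), fun j => Dx_tf _ _ _, fun j => Dx_tf _ _ _, fun q => ?_,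
    fun q => ?_, fun q => ?_, ?_, ?_⟩
  · simp only [tf_app]
    have := Real.sin_sq_add_cos_sq (S q.1); linarith
  · simp only [tf_app]
    rw [abs_mul, abs_of_pos hτ]
    nlinarith [saw_le (q.1 / τ + 0)]
  · simp only [tf_app]
    rw [abs_mul, abs_of_pos hτ]
    nlinarith [saw_le (q.1 / τ + 1 / 2)]
  · refine ext' fun q => ?_
    simp only [mul_app, sub_app, one_app, zero_app, Dt_tf, tf_app, hgd]
    rcases le_or_gt (Real.cos (2 * Real.pi * (q.1 / τ))) (-1 / 2) with h | h
    · have : S q.1 = 0 := by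
        simp only [S]
        rw [Real.smoothTransition.zero_of_nonpos (by linarith), mul_zero]
      rw [this]; simp
    · rw [saw_deriv (by simpa using h)]; simp
  · refine ext' fun q => ?_
    simp only [mul_app, sub_app, one_app, zero_app, Dt_tf, tf_app, hgd]
    rcases le_or_gt (1 / 2) (Real.cos (2 * Real.pi * (q.1 / τ))) with h | h
    · have : S q.1 = Real.pi / 2 := by
        simp only [S]
        rw [Real.smoothTransition.one_of_one_le (by linarith), mul_one]
      rw [this]; simp
    · rw [saw_deriv]
      · simp
      · have e : 2 * Real.pi * (q.1 / τ + 1 / 2) = 2 * Real.pi * (q.1 / τ) + Real.pi := by ring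
        rw [e, Real.cos_add_pi]; linarith

/-- wave covector -/
def nn (m : Fin 3) (g : P) (v : Fin 3 → P) (j : Fin 3) : P :=
  con (if j = m then 1 else 0) - g * Dx j (v m)

/-- wave amplitude -/
def uu (m : Fin 3) (g : P) (v : Fin 3 → P) (f : P) (η : Fin 3 → ℝ) (i : Fin 3) : P :=
  f * (con (η i) * nn m g v m - con (if i = m then 1 else 0) * ∑ j, con (η j) * nn m g v j)

theorem con_add (a b : ℝ) : con (a + b) = con a + con b := map_add (algebraMap ℝ P) a b

theorem uu_nn (m : Fin 3) (g : P) (v : Fin 3 → P) (f : P) (η : Fin 3 → ℝ) :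
    ∑ i, uu m g v f η i * nn m g v i = 0 := by
  have h1 : con 1 = 1 := map_one (algebraMap ℝ P)
  have h0 : con 0 = 0 := map_zero (algebraMap ℝ P)
  fin_cases m <;> simp [uu, Fin.sum_univ_three, h0, h1] <;> ring

theorem uu_E (m : Fin 3) (g : P) (v : Fin 3 → P) (f : P) (η : Fin 3 → ℝ) (i : Fin 3) :
    uu m g v f η i = ∑ j, (f * (con (η i) * con (if j = m then 1 else 0)
      - con (if i = m then 1 else 0) * con (η j))) * nn m g v j := by
  have h1 : con 1 = 1 := map_one (algebraMap ℝ P)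
  have h0 : con 0 = 0 := map_zero (algebraMap ℝ P)
  fin_cases m <;> simp [uu, Fin.sum_univ_three, h0, h1] <;> ring

section bounds
variable {m : Fin 3} {g : P} {v : Fin 3 → P} {C τ : ℝ} (hC : 0 ≤ C)
  (hD : ∀ j q, |Dx j (v m) q| ≤ C) (hg : ∀ q, |g q| ≤ τ)

theorem nn_sub (hC : 0 ≤ C) (hD : ∀ j q, |Dx j (v m) q| ≤ C) (hg : ∀ q, |g q| ≤ τ)
    (j : Fin 3) (q : QQ) : |nn m g v j q - (if j = m then 1 else 0)| ≤ τ * C := by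
  simp only [nn, sub_app, con_app, mul_app]
  rw [sub_sub_cancel_left, abs_neg, abs_mul]
  exact mul_le_mul (hg q) (hD j q) (abs_nonneg _) ((abs_nonneg _).trans (hg q))

theorem nn_le (hC : 0 ≤ C) (hD : ∀ j q, |Dx j (v m) q| ≤ C) (hg : ∀ q, |g q| ≤ τ)
    (hs : τ * C ≤ 1 / 20) (j : Fin 3) (q : QQ) : |nn m g v j q| ≤ 2 := by
  have := abs_le.1 (nn_sub hC hD hg j q)
  rw [abs_le]
  split_ifs at this <;> constructor <;> linarith

theorem uu_sub (hC : 0 ≤ C) (hD : ∀ j q, |Dx j (v m) q| ≤ C) (hg : ∀ q, |g q| ≤ τ)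
    {η : Fin 3 → ℝ} (hη : η m = 0) (hη1 : ∀ i, |η i| ≤ 1) (f : P) {A : ℝ}
    (hf : ∀ q, |f q| ≤ A) (i : Fin 3) (q : QQ) :
    |uu m g v f η i q - f q * η i| ≤ 4 * A * (τ * C) := by
  have hb : ∀ j, |nn m g v j q - (if j = m then 1 else 0)| ≤ τ * C := fun j => nn_sub hC hD hg j q
  have e : uu m g v f η i q - f q * η i = f q * (η i * (nn m g v m q - 1)
      - (if i = m then 1 else 0) * ∑ j, η j * (nn m g v j q - (if j = m then 1 else 0))) := by
    simp only [uu, mul_app, sub_app, con_app, sum_app]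
    have : ∑ j, η j * (nn m g v j q - (if j = m then 1 else 0)) = ∑ j, η j * nn m g v j q := by
      simp only [mul_sub, Finset.sum_sub_distrib]
      simp [hη]
    rw [this]; ring
  have hA : 0 ≤ A := (abs_nonneg _).trans (hf q)
  have hs : 0 ≤ τ * C := (abs_nonneg _).trans (hb m)
  have m1 : ∀ {x y B : ℝ}, |x| ≤ 1 → |y| ≤ B → |x * y| ≤ B := by
    intro x y C hx hy
    rw [abs_mul]
    nlinarith [abs_nonneg x, abs_nonneg y]
  rw [e, abs_mul]
  have h1 : |η i * (nn m g v m q - 1)| ≤ τ * C := m1 (hη1 i) (by simpa using hb m)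
  have h2 : |(if i = m then (1:ℝ) else 0) * ∑ j, η j * (nn m g v j q - (if j = m then 1 else 0))|
      ≤ 3 * (τ * C) := by
    refine m1 (by split_ifs <;> simp) ((Finset.abs_sum_le_sum_abs _ _).trans ?_)
    refine (Finset.sum_le_card_nsmul _ _ (τ * C) fun j _ => m1 (hη1 j) (hb j)).trans ?_
    simp
  have h3 := (abs_sub _ _).trans (add_le_add h1 h2)
  refine (mul_le_mul (hf q) h3 (abs_nonneg _) hA).trans (le_of_eq (by ring))

theorem uu_le (hC : 0 ≤ C) (hD : ∀ j q, |Dx j (v m) q| ≤ C) (hg : ∀ q, |g q| ≤ τ)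
    (hs : τ * C ≤ 1 / 20)
    {η : Fin 3 → ℝ} (hη : η m = 0) (hη1 : ∀ i, |η i| ≤ 1) (f : P) {A : ℝ}
    (hf : ∀ q, |f q| ≤ A) (i : Fin 3) (q : QQ) :
    |uu m g v f η i q| ≤ 2 * A := by
  have h1 := uu_sub hC hD hg hη hη1 f hf i q
  have hA : 0 ≤ A := (abs_nonneg _).trans (hf q)
  have h2 : |f q * η i| ≤ A := by
    rw [abs_mul]; nlinarith [hf q, hη1 i, abs_nonneg (η i), abs_nonneg (f q)]
  have h3 : |uu m g v f η i q| ≤ |uu m g v f η i q - f q * η i| + |f q * η i| := by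
    simpa using abs_add_le (uu m g v f η i q - f q * η i) (f q * η i)
  nlinarith

end bounds

end P

namespace P

theorem abs_mul_le_of {x y B : ℝ} (hx : |x| ≤ 1) (hy : |y| ≤ B) : |x * y| ≤ B := by
  rw [abs_mul]
  nlinarith [abs_nonneg x, abs_nonneg y]

theorem half_wave {T T' : ℝ} {v' : Fin 3 → P} {R' : Fin 3 → Fin 3 → P} (hsub : Sub T v' R')
    (hT : T ≤ T') (m : Fin 3) (v : Fin 3 → P) (η : Fin 3 → ℝ) (hη : η m = 0)
    (hη1 : ∀ i, |η i| ≤ 1) (a α g : P) {A C τ ρ : ℝ} (haS : Supp T' a) (ha : ∀ q, |a q| ≤ A)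
    (hα : ∀ q, |α q| ≤ 1) (hgx : ∀ j, Dx j g = 0) (hg : ∀ q, |g q| ≤ τ)
    (hαg : α * (1 - Dt g) = 0) (hC : 0 ≤ C)
    (hD : ∀ j q, |Dx j (v m) q| ≤ C) (hM : ∀ q, |(Dt (v m) + ∑ j, v j * Dx j (v m)) q| ≤ C)
    (hs : τ * C ≤ 1 / 20) (hρ : ∀ q, |∑ j, (v' j q - v j q) * nn m g v j q| ≤ ρ)
    (ε : ℝ) (hε : 0 < ε) :
    ∃ (v'' : Fin 3 → P) (R'' : Fin 3 → Fin 3 → P), Sub T' v'' R'' ∧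
      (∃ c : QQ → ℝ, (∀ q, |c q| ≤ 1) ∧
        ∀ i q, |v'' i q - v' i q - uu m g v (α * a) η i q * c q| ≤ ε) ∧
      ∀ i j q, |R'' i j q - R' i j q - uu m g v (α * a) η i q * uu m g v (α * a) η j q / 2|
        ≤ 32 * A * (τ * C + ρ) + ε := by
  have lb : ∀ (d : Derivation ℝ P P) (x y : P), d (x * y) = x * d y + y * d x := by
    intro d x y; simp [Derivation.leibniz]
  have hnm : ∀ q, 1 / 2 ≤ nn m g v m q := fun q => by
    have := abs_le.1 (nn_sub hC hD hg m q)
    simp only [if_true] at this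
    linarith
  have hnsq : ∀ q, 1 / 4 ≤ (∑ j, nn m g v j * nn m g v j) q := fun q => by
    rw [sum_app]
    have h1 : (nn m g v m * nn m g v m) q ≤ ∑ j, (nn m g v j * nn m g v j) q :=
      Finset.single_le_sum (f := fun j => (nn m g v j * nn m g v j) q)
        (fun j _ => mul_self_nonneg (nn m g v j q)) (Finset.mem_univ m)
    refine le_trans ?_ h1
    simp only [mul_app]
    nlinarith [hnm q]
  obtain ⟨ν, hν⟩ := exists_inv (∑ j, nn m g v j * nn m g v j) (fun q => by
    have := hnsq q
    intro h0
    rw [h0] at this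
    norm_num at this)
  have hν4 : ∀ q, |ν q| ≤ 4 := fun q => by
    have h1 := congrArg (fun f : P => f q) hν
    simp only [mul_app, one_app] at h1
    have h2 := hnsq q
    simp only [sum_app, mul_app] at h1 h2
    have h3 : ν q = (∑ j, nn m g v j q * nn m g v j q)⁻¹ := eq_inv_of_mul_eq_one_left h1
    rw [h3, abs_of_pos (by positivity)]
    rw [inv_le_comm₀ (by linarith) (by norm_num)]
    linarith
  have hA : 0 ≤ A := (abs_nonneg _).trans (ha (0, 0))
  have hρ0 : 0 ≤ ρ := (abs_nonneg _).trans (hρ (0, 0))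
  have hτC : 0 ≤ τ * C := mul_nonneg ((abs_nonneg _).trans (hg (0, 0))) hC
  let h : P := Dt (-(g * v m)) + ∑ j, v' j * nn m g v j
  have hαh : ∀ q, |h q * α q| ≤ τ * C + ρ := by
    intro q
    have e1 : h * α = -(α * (g * (Dt (v m) + ∑ j, v j * Dx j (v m))))
        + α * ∑ j, (v' j - v j) * nn m g v j := by
      have e2 : ∑ j, v j * nn m g v j = v m - g * ∑ j, v j * Dx j (v m) := by
        have h1 : con 1 = 1 := map_one (algebraMap ℝ P)
        have h0 : con 0 = 0 := map_zero (algebraMap ℝ P)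
        have : ∀ j, v j * nn m g v j = (if j = m then v j else 0) - g * (v j * Dx j (v m)) := by
          intro j
          unfold nn
          split_ifs
          · rw [h1]; ring
          · rw [h0]; ring
        simp only [this, Finset.sum_sub_distrib, ← Finset.mul_sum]
        simp
      simp only [h, map_neg, lb]
      have e3 : ∑ j, (v' j - v j) * nn m g v j = ∑ j, v' j * nn m g v j - ∑ j, v j * nn m g v j := by
        simp only [sub_mul, Finset.sum_sub_distrib]
      rw [e3, e2]
      linear_combination v m * hαg
    have e4 := congrArg (fun f : P => f q) e1
    simp only [mul_app] at e4
    rw [e4]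
    simp only [add_app, neg_app, mul_app]
    refine (abs_add_le _ _).trans (add_le_add ?_ ?_)
    · rw [abs_neg]
      refine abs_mul_le_of (hα q) ?_
      rw [abs_mul]
      exact mul_le_mul (hg q) (hM q) (abs_nonneg _) ((abs_nonneg _).trans (hg q))
    · refine abs_mul_le_of (hα q) ?_
      simpa using hρ q
  have hUα : ∀ i q, uu m g v (α * a) η i q = α q * uu m g v a η i q := fun i q => by
    simp only [uu, mul_app]; ring
  have hhu : ∀ i q, |h q * uu m g v (α * a) η i q| ≤ (τ * C + ρ) * (2 * A) := fun i q => by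
    rw [hUα, ← mul_assoc, abs_mul]
    exact mul_le_mul (hαh q) (uu_le hC hD hg hs hη hη1 a ha i q) (abs_nonneg _) (by linarith)
  refine wave_step hsub hT m (-(g * v m)) (fun i j => (α * a) * (con (η i) * con (if j = m then 1 else 0)
      - con (if i = m then 1 else 0) * con (η j))) (fun i j => by ring)
      (fun i j => Supp.mul_right _ (Supp.mul_left _ haS)) (nn m g v) (uu m g v (α * a) η) ?_
      (fun i => uu_E m g v (α * a) η i) ν hν h rfl (32 * A * (τ * C + ρ)) ?_ ε hε
  · intro j
    rw [map_neg, lb, hgx]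
    unfold nn; ring
  · intro i j q
    have e : (h * (uu m g v (α * a) η i * nn m g v j + nn m g v i * uu m g v (α * a) η j) * ν) q
        = ((h q * uu m g v (α * a) η i q) * nn m g v j q
          + (h q * uu m g v (α * a) η j q) * nn m g v i q) * ν q := by
      simp only [mul_app, add_app]; ring
    rw [e, abs_mul]
    have hB : 0 ≤ (τ * C + ρ) * (2 * A) := by positivity
    have h1 : ∀ i j, |(h q * uu m g v (α * a) η i q) * nn m g v j q| ≤ (τ * C + ρ) * (2 * A) * 2 :=
      fun i j => by
        rw [abs_mul]
        exact mul_le_mul (hhu i q) (nn_le hC hD hg hs j q) (abs_nonneg _) hB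
    refine (mul_le_mul ((abs_add_le _ _).trans (add_le_add (h1 i j) (h1 j i))) (hν4 q) (abs_nonneg _)
      (by positivity)).trans (le_of_eq (by ring))

theorem pair_wave {T T' : ℝ} {v : Fin 3 → P} {R : Fin 3 → Fin 3 → P} (hsub : Sub T v R)
    (hT : T ≤ T') (m : Fin 3) (η : Fin 3 → ℝ) (hη : η m = 0)
    (hη1 : ∀ i, |η i| ≤ 1) (a : P) {A : ℝ} (haS : Supp T' a) (ha : ∀ q, |a q| ≤ A)
    (ε : ℝ) (hε : 0 < ε) :
    ∃ (v' : Fin 3 → P) (R' : Fin 3 → Fin 3 → P), Sub T' v' R' ∧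
      (∀ i q, |v' i q - v i q| ≤ 4 * A + ε) ∧
      ∀ i j q, |R' i j q - R i j q - a q ^ 2 * (η i * η j) / 2| ≤ ε := by
  have hA : 0 ≤ A := (abs_nonneg _).trans (ha (0, 0))
  obtain ⟨C1, hC1, B1⟩ := bounded_fam (fun j => Dx j (v m)) (fun j => (hsub.sv m).Dx j)
  obtain ⟨C2, hC2, B2⟩ := bounded_of_supp (f := Dt (v m) + ∑ j, v j * Dx j (v m))
    ((hsub.sv m).Dt.add (Supp.sum fun j => Supp.mul_left _ ((hsub.sv m).Dx j)))
  let C := C1 + C2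
  have hC : 0 ≤ C := add_nonneg hC1 hC2
  have hD : ∀ j q, |Dx j (v m) q| ≤ C := fun j q => (B1 j q).trans (by simp only [C]; linarith)
  have hM : ∀ q, |(Dt (v m) + ∑ j, v j * Dx j (v m)) q| ≤ C := fun q =>
    (B2 q).trans (by simp only [C]; linarith)
  -- choice of the small parameters
  let W : ℝ := 1 + 100 * A + 1000 * A * A
  have hW : 1 ≤ W := by simp only [W]; nlinarith
  let ε1 : ℝ := ε / (800 * W)
  have hε1 : 0 < ε1 := by simp only [ε1]; positivity
  have hε1W : ε1 * W = ε / 800 := by simp only [ε1]; field_simp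
  let σ0 : ℝ := min (1 / 20) ε1
  have hσ0 : 0 < σ0 := lt_min (by norm_num) hε1
  let τ : ℝ := σ0 / (C + 1)
  have hτ : 0 < τ := div_pos hσ0 (by linarith)
  have hτC : τ * C ≤ σ0 := by
    simp only [τ]
    rw [div_mul_eq_mul_div, div_le_iff₀ (by linarith)]
    nlinarith
  have hs : τ * C ≤ 1 / 20 := hτC.trans (min_le_left _ _)
  have hs1 : τ * C ≤ ε1 := hτC.trans (min_le_right _ _)
  have hs0 : 0 ≤ τ * C := by positivity
  obtain ⟨α, β, g, g', hgx, hgx', hαβ, hg, hg', hαg, hβg⟩ := exists_time τ hτ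
  have hα : ∀ q, |α q| ≤ 1 := fun q => by
    rw [← sq_le_one_iff_abs_le_one]; nlinarith [hαβ q, mul_self_nonneg (β q)]
  have hβ : ∀ q, |β q| ≤ 1 := fun q => by
    rw [← sq_le_one_iff_abs_le_one]; nlinarith [hαβ q, mul_self_nonneg (α q)]
  obtain ⟨v1, R1, hsub1, ⟨c, hc, hv1⟩, hR1⟩ := half_wave hsub hT m v η hη hη1 a α g haS ha hα hgx hg
    hαg hC hD hM hs (ρ := 0) (by simp) ε1 hε1
  have haα : ∀ q, |(α * a) q| ≤ A := fun q => abs_mul_le_of (hα q) (ha q)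
  have haβ : ∀ q, |(β * a) q| ≤ A := fun q => abs_mul_le_of (hβ q) (ha q)
  have hu := uu_le hC hD hg hs hη hη1 (α * a) haα
  have hu' := uu_le hC hD hg' hs hη hη1 (β * a) haβ
  have hρ : ∀ q, |∑ j, (v1 j q - v j q) * nn m g' v j q| ≤ 12 * A * ε1 + 6 * ε1 := by
    intro q
    have h0 := congrArg (fun f : P => f q) (uu_nn m g v (α * a) η)
    simp only [sum_app, mul_app, zero_app] at h0
    have e : ∑ j, (v1 j q - v j q) * nn m g' v j q
        = ∑ j, (c q * (uu m g v (α * a) η j q * (nn m g' v j q - nn m g v j q))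
          + (v1 j q - v j q - uu m g v (α * a) η j q * c q) * nn m g' v j q) := by
      have : ∑ j, (c q * (uu m g v (α * a) η j q * (nn m g' v j q - nn m g v j q))
          + (v1 j q - v j q - uu m g v (α * a) η j q * c q) * nn m g' v j q)
          = ∑ j, (v1 j q - v j q) * nn m g' v j q
            - c q * ∑ j, uu m g v (α * a) η j q * nn m g v j q := by
        rw [Finset.mul_sum, ← Finset.sum_sub_distrib]
        exact Finset.sum_congr rfl fun j _ => by ring
      rw [this, h0]; ring
    rw [e]
    refine (Finset.abs_sum_le_sum_abs _ _).trans ?_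
    refine (Finset.sum_le_card_nsmul _ _ (4 * A * ε1 + 2 * ε1) fun j _ => ?_).trans ?_
    · refine (abs_add_le _ _).trans (add_le_add ?_ ?_)
      · refine abs_mul_le_of (hc q) ?_
        have h1 := nn_sub hC hD hg j q
        have h2 := nn_sub hC hD hg' j q
        have h3 : |nn m g' v j q - nn m g v j q| ≤ 2 * ε1 := by
          rw [abs_le] at h1 h2 ⊢
          constructor <;> linarith
        rw [abs_mul]
        exact (mul_le_mul (hu j q) h3 (abs_nonneg _) (by positivity)).trans (le_of_eq (by ring))
      · rw [abs_mul]
        exact (mul_le_mul (hv1 j q) (nn_le hC hD hg' hs j q) (abs_nonneg _) hε1.le).trans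
          (le_of_eq (by ring))
    · simp only [Finset.card_univ, Fintype.card_fin, nsmul_eq_mul]
      push_cast
      linarith
  obtain ⟨v2, R2, hsub2, ⟨c', hc', hv2⟩, hR2⟩ := half_wave hsub1 le_rfl m v η hη hη1 a β g' haS ha hβ
    hgx' hg' hβg hC hD hM hs hρ ε1 hε1
  have hWe : ε1 * 1 + 100 * (ε1 * A) + 1000 * (ε1 * (A * A)) = ε / 800 := by
    rw [← hε1W]; simp only [W]; ring
  have p1 : 0 ≤ ε1 * A := by positivity
  have p2 : 0 ≤ ε1 * (A * A) := by positivity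
  refine ⟨v2, R2, hsub2, fun i q => ?_, fun i j q => ?_⟩
  · have h1 := hv1 i q
    have h2 := hv2 i q
    have h3 : |c q * uu m g v (α * a) η i q| ≤ 2 * A := abs_mul_le_of (hc q) (hu i q)
    have h4 : |c' q * uu m g' v (β * a) η i q| ≤ 2 * A := abs_mul_le_of (hc' q) (hu' i q)
    rw [abs_le] at *
    constructor <;> nlinarith
  · have h1 := hR1 i j q
    have h2 := hR2 i j q
    have key : ∀ (f : P) (w : P) (_ : ∀ q, |(f * a) q| ≤ A) (_ : ∀ q, |w q| ≤ τ),
        |uu m w v (f * a) η i q * uu m w v (f * a) η j q - (f q * a q * η i) * (f q * a q * η j)|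
          ≤ 12 * (ε1 * (A * A)) := by
      intro f w hf hw
      have k1 := uu_sub hC hD hw hη hη1 (f * a) hf
      have k2 := uu_le hC hD hw hs hη hη1 (f * a) hf i q
      have k3 : |f q * a q * η j| ≤ A := by
        rw [mul_comm]; exact abs_mul_le_of (hη1 j) (hf q)
      have k4 : ∀ i, |uu m w v (f * a) η i q - f q * a q * η i| ≤ 4 * A * ε1 := fun i =>
        (k1 i q).trans (mul_le_mul_of_nonneg_left hs1 (by positivity))
      have e : uu m w v (f * a) η i q * uu m w v (f * a) η j q - (f q * a q * η i) * (f q * a q * η j)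
        = uu m w v (f * a) η i q * (uu m w v (f * a) η j q - f q * a q * η j)
          + (uu m w v (f * a) η i q - f q * a q * η i) * (f q * a q * η j) := by ring
      rw [e]
      refine (abs_add_le _ _).trans ?_
      rw [abs_mul, abs_mul]
      have q1 := mul_le_mul k2 (k4 j) (abs_nonneg _) (by positivity)
      have q2 := mul_le_mul (k4 i) k3 (abs_nonneg _) (by positivity)
      linarith
    have k1 := key α g haα hg
    have k2 := key β g' haβ hg'
    have e : (α q * a q * η i) * (α q * a q * η j) + (β q * a q * η i) * (β q * a q * η j)
        = a q ^ 2 * (η i * η j) := by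
      linear_combination (a q ^ 2 * (η i * η j)) * hαβ q
    have r1 : 32 * A * (τ * C + 0) ≤ 32 * (ε1 * A) := by
      nlinarith [mul_le_mul_of_nonneg_left hs1 hA]
    have r2 : 32 * A * (τ * C + (12 * A * ε1 + 6 * ε1)) ≤ 300 * (ε1 * A) + 400 * (ε1 * (A * A)) := by
      nlinarith [mul_le_mul_of_nonneg_left hs1 hA]
    rw [abs_le] at *
    constructor <;> linarith
end P

namespace P

theorem multi_wave {T' : ℝ} {A : ℝ} (hA : 0 ≤ A) (ε : ℝ) (hε : 0 < ε)
    (L : List (Fin 3 × (Fin 3 → ℝ) × P))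
    (hL : ∀ x ∈ L, x.2.1 x.1 = 0 ∧ (∀ i, |x.2.1 i| ≤ 1) ∧ Supp T' x.2.2 ∧ ∀ q, |x.2.2 q| ≤ A) :
    ∀ {T : ℝ} {v : Fin 3 → P} {R : Fin 3 → Fin 3 → P}, Sub T v R → T ≤ T' →
    ∃ (v' : Fin 3 → P) (R' : Fin 3 → Fin 3 → P), Sub T' v' R' ∧
      (∀ i q, |v' i q - v i q| ≤ L.length * (4 * A + ε)) ∧
      ∀ i j q, |R' i j q - R i j q - (L.map fun x => x.2.2 q ^ 2 * (x.2.1 i * x.2.1 j) / 2).sum|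
        ≤ L.length * ε := by
  induction L with
  | nil =>
    intro T v R h hT
    exact ⟨v, R, ⟨fun i => (h.sv i).mono hT, fun i j => (h.sR i j).mono hT, h.symm, h.div, h.mom⟩,
      by simp, by simp⟩
  | cons x L ih =>
    intro T v R h hT
    obtain ⟨h1, h2, h3, h4⟩ := hL x (by simp)
    obtain ⟨v1, R1, s1, hv1, hR1⟩ := pair_wave h hT x.1 x.2.1 h1 h2 x.2.2 h3 h4 ε hε
    obtain ⟨v2, R2, s2, hv2, hR2⟩ := ih (fun y hy => hL y (by simp [hy])) s1 le_rfl
    refine ⟨v2, R2, s2, fun i q => ?_, fun i j q => ?_⟩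
    · have k1 := hv1 i q
      have k2 := hv2 i q
      simp only [List.length_cons]
      push_cast
      rw [abs_le] at *
      constructor <;> linarith
    · have k1 := hR1 i j q
      have k2 := hR2 i j q
      simp only [List.length_cons, List.map_cons, List.sum_cons]
      push_cast
      rw [abs_le] at *
      constructor <;> linarith

theorem exists_cutoff {T T' : ℝ} (hT0 : 0 ≤ T) (hT : T < T') : ∃ χ : P, (∀ j, Dx j χ = 0) ∧
    Supp T' χ ∧ (∀ q : QQ, |q.1| ≤ T → χ q = 1) ∧ ∀ q, |χ q| ≤ 1 := by
  have hS : ContDiff ℝ ∞ Real.smoothTransition := Real.smoothTransition.contDiff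
  have hd : 0 < T' ^ 2 - T ^ 2 := by nlinarith
  refine ⟨tf (fun t => Real.smoothTransition ((T' ^ 2 - t ^ 2) / (T' ^ 2 - T ^ 2)))
    (hS.comp (by fun_prop)), fun j => Dx_tf _ _ _, fun q hq => ?_, fun q hq => ?_, fun q => ?_⟩
  · simp only [tf_app]
    refine Real.smoothTransition.zero_of_nonpos (div_nonpos_of_nonpos_of_nonneg ?_ hd.le)
    rw [← sq_abs q.1]
    nlinarith [abs_nonneg q.1]
  · simp only [tf_app]
    refine Real.smoothTransition.one_of_one_le ?_
    rw [le_div_iff₀ hd, ← sq_abs q.1]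
    nlinarith [abs_nonneg q.1]
  · simp only [tf_app]
    rw [abs_of_nonneg (Real.smoothTransition.nonneg _)]
    exact Real.smoothTransition.le_one _

/-- squared amplitude -/
def famp (κ : ℝ) (R : Fin 3 → Fin 3 → P) (m : Fin 3) (σ : ℝ) : P :=
  con (1 / 2) * (con (κ ^ 2) - R (m + 1) (m + 1) - R (m + 2) (m + 2) + R m m)
    - con σ * R (m + 1) (m + 2)

/-- polarization -/
def feta (m : Fin 3) (σ : ℝ) (i : Fin 3) : ℝ := if i = m + 1 then 1 else if i = m + 2 then σ else 0

theorem stage {T T' : ℝ} {v : Fin 3 → P} {R : Fin 3 → Fin 3 → P} (hsub : Sub T v R)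
    (hT0 : 0 ≤ T) (hT : T < T') (κ : ℝ) (hκ : 0 < κ) (hR : ∀ i j q, |R i j q| ≤ κ ^ 2 / 10)
    (ε : ℝ) (hε : 0 < ε) :
    ∃ (v' : Fin 3 → P) (R' : Fin 3 → Fin 3 → P), Sub T' v' R' ∧
      (∀ i q, |v' i q - v i q| ≤ 25 * κ) ∧ ∀ i j q, |R' i j q| ≤ ε := by
  obtain ⟨χ, hχx, hχS, hχ1, hχ⟩ := exists_cutoff hT0 hT
  have hκ2 : 0 < κ ^ 2 := by positivity
  have hbd : ∀ m σ, |σ| ≤ 1 → ∀ q, 0 < famp κ R m σ q ∧ famp κ R m σ q ≤ κ ^ 2 := by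
    intro m σ hσ q
    simp only [famp, mul_app, sub_app, add_app, con_app]
    have h1 := abs_le.1 (hR (m + 1) (m + 1) q)
    have h2 := abs_le.1 (hR (m + 2) (m + 2) q)
    have h3 := abs_le.1 (hR m m q)
    have h4 := abs_le.1 (abs_mul_le_of hσ (hR (m + 1) (m + 2) q))
    constructor <;> linarith
  have hex : ∀ m σ, ∃ b : P, |σ| ≤ 1 → ∀ q, b q = Real.sqrt (famp κ R m σ q) := by
    intro m σ
    by_cases h : |σ| ≤ 1
    · obtain ⟨b, hb⟩ := exists_sqrt (famp κ R m σ) fun q => (hbd m σ h q).1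
      exact ⟨b, fun _ => hb⟩
    · exact ⟨0, fun h' => absurd h' h⟩
  choose b hb using hex
  have hbsq : ∀ m σ, |σ| ≤ 1 → ∀ q, (χ * b m σ) q ^ 2 = χ q ^ 2 * famp κ R m σ q := by
    intro m σ h q
    rw [mul_app, hb m σ h, mul_pow, Real.sq_sqrt (hbd m σ h q).1.le]
  have hble : ∀ m σ, |σ| ≤ 1 → ∀ q, |(χ * b m σ) q| ≤ κ := by
    intro m σ h q
    rw [mul_app]
    refine abs_mul_le_of (hχ q) ?_
    rw [hb m σ h, abs_of_nonneg (Real.sqrt_nonneg _)]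
    exact Real.sqrt_le_iff.2 ⟨hκ.le, (hbd m σ h q).2⟩
  let el : Fin 3 → ℝ → Fin 3 × (Fin 3 → ℝ) × P := fun m σ => (m, feta m σ, χ * b m σ)
  have hel : ∀ m σ, |σ| ≤ 1 → ((el m σ).2.1 (el m σ).1 = 0 ∧ (∀ i, |(el m σ).2.1 i| ≤ 1) ∧
      Supp T' (el m σ).2.2 ∧ ∀ q, |(el m σ).2.2 q| ≤ κ) := by
    intro m σ h
    refine ⟨?_, ?_, Supp.mul_right _ hχS, hble m σ h⟩
    · simp only [el, feta]
      fin_cases m <;> simp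
    · intro i
      simp only [el, feta]
      split_ifs <;> simp [h]
  have s1 : |(1 : ℝ)| ≤ 1 := by norm_num
  have s2 : |(-1 : ℝ)| ≤ 1 := by norm_num
  let ε' := min (ε / 6) (κ / 6)
  have hε' : 0 < ε' := lt_min (by positivity) (by positivity)
  have he1 : ε' ≤ ε / 6 := min_le_left _ _
  have he2 : ε' ≤ κ / 6 := min_le_right _ _
  obtain ⟨v', R', hs', hv', hR'⟩ := multi_wave hκ.le ε' hε'
    [el 0 1, el 0 (-1), el 1 1, el 1 (-1), el 2 1, el 2 (-1)] (by
      simp only [List.mem_cons, List.not_mem_nil, or_false]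
      rintro x (rfl | rfl | rfl | rfl | rfl | rfl)
      exacts [hel _ _ s1, hel _ _ s2, hel _ _ s1, hel _ _ s2, hel _ _ s1, hel _ _ s2]) hsub hT.le
  simp only [List.length_cons, List.length_nil, List.map_cons, List.map_nil, List.sum_cons,
    List.sum_nil, el] at hv' hR'
  simp only [hbsq _ _ s1, hbsq _ _ s2] at hR'
  have hχR : ∀ i j q, χ q ^ 2 * R i j q = R i j q := by
    intro i j q
    by_cases h : T < |q.1|
    · rw [hsub.sR i j q h]; simp
    · rw [hχ1 q (not_lt.1 h)]; simp
  let ρ : P := con (κ ^ 2) * (χ * χ)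
  have hρx : ∀ j, Dx j ρ = 0 := by
    intro j
    simp only [ρ, Derivation.leibniz, hχx, smul_zero, add_zero]
    rw [show Dx j (con (κ ^ 2)) = 0 from dd_con _ _]
    simp
  refine ⟨v', fun i j => R' i j - (if i = j then ρ else 0), ⟨hs'.sv, fun i j => ?_, fun i j => ?_,
    hs'.div, fun i => ?_⟩, fun i q => ?_, fun i j q => ?_⟩
  · refine (hs'.sR i j).sub ?_
    split_ifs
    · exact Supp.mul_left _ (Supp.mul_left _ hχS)
    · exact Supp.zero _
  · rw [hs'.symm i j]
    simp only [eq_comm]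
  · rw [hs'.mom]
    refine Finset.sum_congr rfl fun j _ => ?_
    rw [map_sub]
    split_ifs
    · rw [hρx, sub_zero]
    · rw [map_zero, sub_zero]
  · refine (hv' i q).trans ?_
    push_cast
    linarith
  · have key := hR' i j q
    refine le_trans (le_of_eq ?_) (key.trans ?_)
    · congr 1
      rw [sub_app, sub_sub]
      congr 1
      have e10 : R 1 0 = R 0 1 := hsub.symm _ _
      have e20 : R 2 0 = R 0 2 := hsub.symm _ _
      have e21 : R 2 1 = R 1 2 := hsub.symm _ _
      have x00 := hχR 0 0 q
      have x01 := hχR 0 1 q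
      have x02 := hχR 0 2 q
      have x11 := hχR 1 1 q
      have x12 := hχR 1 2 q
      have x22 := hχR 2 2 q
      have f1 : (1 : Fin 3) + 1 = 2 := rfl
      have f2 : (1 : Fin 3) + 2 = 0 := rfl
      have f3 : (2 : Fin 3) + 1 = 0 := rfl
      have f4 : (2 : Fin 3) + 2 = 1 := rfl
      fin_cases i <;> fin_cases j <;>
        simp [feta, famp, ρ, f1, f2, f3, f4, e10, e20, e21] <;> 
        first
        | linear_combination -x00
        | linear_combination -x01
        | linear_combination -x02
        | linear_combination -x11
        | linear_combination -x12
        | linear_combination -x22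
        | linear_combination x00
        | linear_combination x01
        | linear_combination x02
        | linear_combination x11
        | linear_combination x12
        | linear_combination x22
    · push_cast
      linarith
end P

namespace P

theorem initial (ε : ℝ) (hε : 0 < ε) : ∃ (v : Fin 3 → P) (R : Fin 3 → Fin 3 → P), Sub 1 v R ∧
    (∀ i j q, |R i j q| ≤ ε) ∧ v 0 (0, 0) = 1 := by
  obtain ⟨χ, hχx, hχS, hχ1, hχ⟩ := exists_cutoff (T := 1 / 2) (T' := 1) (by norm_num) (by norm_num)
  obtain ⟨C, hC, hCb⟩ := bounded_of_supp (hχS.Dt)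
  obtain ⟨N, hN⟩ := exists_nat_ge (C / ε + 1)
  have hN1 : (1 : ℝ) ≤ N := le_trans (by have := div_nonneg hC hε.le; linarith) hN
  set om : ℝ := 2 * Real.pi * N with hom
  have homN : (N : ℝ) ≤ om := by
    have := Real.pi_gt_three
    nlinarith
  have hom0 : 0 < om := by linarith
  have hCom : om⁻¹ * C ≤ ε := by
    have h1 : C / ε ≤ om := by linarith
    rw [div_le_iff₀ hε] at h1
    rw [inv_mul_le_iff₀ hom0]; exact h1
  have lb : ∀ (d : Derivation ℝ P P) (x y : P), d (x * y) = x * d y + y * d x := by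
    intro d x y; simp [Derivation.leibniz]
  let c := cosP 1 0 N
  let s := sinP 1 0 N
  have h1 : con 1 = 1 := map_one (algebraMap ℝ P)
  have h0 : con 0 = 0 := map_zero (algebraMap ℝ P)
  have hc0 : Dx 0 c = 0 := by simp [Dx, c, dd_cosP, h0]
  have hs0 : Dx 0 s = 0 := by simp [Dx, s, dd_sinP, h0]
  have hs1 : Dx 1 s = con om * c := by simp [Dx, s, dd_sinP, h1, hom, c]
  have htc : Dt c = 0 := by simp [Dt, c, dd_cosP, h0]
  let ρ : P := con om⁻¹ * (Dt χ * s)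
  have hkl : con om⁻¹ * con om = 1 := ext' fun q => by simp [hom0.ne']
  have hDχ : ∀ j, Dx j (Dt χ) = 0 := fun j => by
    have := dd_comm (0, Pi.single j 1) (1, 0) χ
    rw [Dx, Dt, this]
    change Dt (Dx j χ) = 0
    rw [hχx, map_zero]
  have hDc : ∀ j r, Dx j (con r) = 0 := fun j r => dd_con _ _
  have hρ0 : Dx 0 ρ = 0 := by simp only [ρ, lb, hDχ, hs0, hDc]; ring
  have hρ1 : Dx 1 ρ = Dt χ * c := by
    simp only [ρ, lb, hDχ, hs1, hDc]
    linear_combination (Dt χ * c) * hkl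
  let v : Fin 3 → P := ![χ * c, 0, 0]
  let R : Fin 3 → Fin 3 → P := ![![0, ρ, 0], ![ρ, 0, 0], ![0, 0, 0]]
  have hρS : Supp 1 ρ := Supp.mul_left _ (Supp.mul_right _ hχS.Dt)
  have hρb : ∀ q, |ρ q| ≤ ε := fun q => by
    simp only [ρ, mul_app, con_app]
    rw [abs_mul, abs_of_pos (by positivity)]
    refine le_trans (mul_le_mul_of_nonneg_left ?_ (by positivity)) hCom
    rw [mul_comm]
    exact abs_mul_le_of (sinP_le _ _ _ q) (hCb q)
  refine ⟨v, R, ⟨?_, ?_, ?_, ?_, ?_⟩, ?_, ?_⟩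
  · intro i
    fin_cases i
    · exact Supp.mul_right _ hχS
    · exact Supp.zero _
    · exact Supp.zero _
  · intro i j
    fin_cases i <;> fin_cases j <;> first | exact hρS | exact Supp.zero _
  · intro i j
    fin_cases i <;> fin_cases j <;> rfl
  · simp [v, Fin.sum_univ_three, lb, hχx, hc0]
  · intro i
    fin_cases i
    · simp [v, R, Fin.sum_univ_three, lb, hχx, hc0, hρ1, htc, mul_comm]
    · simp [v, R, Fin.sum_univ_three, lb, hρ0]
    · simp [v, R, Fin.sum_univ_three, lb]
  · intro i j q
    fin_cases i <;> fin_cases j <;> first | exact hρb q | (simp [R]; exact hε.le)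
  · have : χ (0, 0) = 1 := hχ1 (0, 0) (by norm_num)
    simp [v, this, c, cosP_app]

/-- support radii -/
def Tq (n : ℕ) : ℝ := 2 - (1 / 2) ^ n
/-- amplitudes -/
def Kq (n : ℕ) : ℝ := (1 / 100) * (1 / 2) ^ n

theorem iteration : ∃ (v : ℕ → Fin 3 → P) (R : ℕ → Fin 3 → Fin 3 → P),
    (∀ n, Sub 2 (v n) (R n)) ∧ (∀ n i j q, |R n i j q| ≤ Kq n ^ 2 / 10) ∧
    (∀ n i q, |v (n + 1) i q - v n i q| ≤ 25 * Kq n) ∧ v 0 0 (0, 0) = 1 := by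
  have hK : ∀ n, 0 < Kq n := fun n => by unfold Kq; positivity
  have hT : ∀ n, Tq n < Tq (n + 1) := fun n => by
    unfold Tq
    have : (0 : ℝ) < (1 / 2) ^ n := by positivity
    rw [pow_succ]; linarith
  have hT0 : ∀ n, 0 ≤ Tq n := fun n => by
    unfold Tq
    have : ((1 : ℝ) / 2) ^ n ≤ 1 := pow_le_one₀ (by norm_num) (by norm_num)
    linarith
  have hT2 : ∀ n, Tq n ≤ 2 := fun n => by
    unfold Tq
    have : (0 : ℝ) < (1 / 2) ^ n := by positivity
    linarith
  let X : ℕ → Type := fun n => {p : (Fin 3 → P) × (Fin 3 → Fin 3 → P) //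
    Sub (Tq n) p.1 p.2 ∧ ∀ i j q, |p.2 i j q| ≤ Kq n ^ 2 / 10}
  have hstep : ∀ n (p : X n), ∃ p' : X (n + 1), ∀ i q, |p'.1.1 i q - p.1.1 i q| ≤ 25 * Kq n := by
    rintro n ⟨⟨v, R⟩, hs, hR⟩
    obtain ⟨v', R', h1, h2, h3⟩ := stage hs (hT0 n) (hT n) (Kq n) (hK n) hR (Kq (n + 1) ^ 2 / 10)
      (by have := hK (n + 1); positivity)
    exact ⟨⟨(v', R'), h1, h3⟩, h2⟩
  choose step hst using hstep
  obtain ⟨v0, R0, hs0, hR0, hv0⟩ := initial (Kq 0 ^ 2 / 10) (by have := hK 0; positivity)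
  have hT1 : Tq 0 = 1 := by unfold Tq; norm_num
  let S : ∀ n, X n := fun n => Nat.rec (motive := X) ⟨(v0, R0), by rw [hT1]; exact hs0, hR0⟩ step n
  refine ⟨fun n => (S n).1.1, fun n => (S n).1.2, fun n => ?_, fun n => (S n).2.2, fun n => hst n (S n), hv0⟩
  have h := (S n).2.1
  exact ⟨fun i => (h.sv i).mono (hT2 n), fun i j => (h.sR i j).mono (hT2 n), h.symm, h.div, h.mom⟩

end P

namespace P

/-- space-time integral -/
def II (F : QQ → ℝ) : ℝ := ∫ t : ℝ, ∫ x in Tdom, F (t, x)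

theorem Tdom_vol : volume Tdom = 1 := by
  rw [measure_congr Tdom_ae, Real.volume_Icc_pi]; simp

theorem inner_cont {F : QQ → ℝ} (hF : Continuous F) :
    Continuous (fun t : ℝ => ∫ x in Tdom, F (t, x)) := by
  simp only [setIntegral_congr_set Tdom_ae]
  exact continuous_parametric_integral_of_continuous (f := fun t x => F (t, x))
    (by exact hF) isCompact_Icc

theorem slice_int {F : QQ → ℝ} (hF : Continuous F) (t : ℝ) :
    IntegrableOn (fun x : Spc => F (t, x)) Tdom := by
  have h1 : Continuous (fun x : Spc => F (t, x)) := hF.comp (by fun_prop)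
  exact (h1.continuousOn.integrableOn_compact (isCompact_Icc (a := (0 : Spc)) (b := 1))).congr_set_ae
    Tdom_ae

theorem inner_zero {F : QQ → ℝ} {T : ℝ} (hS : ∀ q : QQ, T < |q.1| → F q = 0) (t : ℝ)
    (ht : t ∉ Set.Icc (-T) T) : ∫ x in Tdom, F (t, x) = 0 := by
  have : T < |t| := by
    rw [← not_le, abs_le]; exact ht
  simp [hS (t, _) this]

theorem inner_int {F : QQ → ℝ} (hF : Continuous F) {T : ℝ} (hS : ∀ q : QQ, T < |q.1| → F q = 0) :
    Integrable (fun t : ℝ => ∫ x in Tdom, F (t, x)) :=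
  (inner_cont hF).integrable_of_hasCompactSupport
    (HasCompactSupport.intro (isCompact_Icc (a := -T) (b := T)) (inner_zero hS))

theorem II_le {F : QQ → ℝ} {T B : ℝ} (hT : 0 ≤ T) (hS : ∀ q : QQ, T < |q.1| → F q = 0)
    (hB : ∀ q, |F q| ≤ B) : |II F| ≤ B * (2 * T) := by
  unfold II
  rw [← setIntegral_eq_integral_of_forall_compl_eq_zero (inner_zero hS)]
  have h1 : ∀ t, ‖∫ x in Tdom, F (t, x)‖ ≤ B := fun t => by
    have := norm_setIntegral_le_of_norm_le_const (f := fun x => F (t, x)) (s := Tdom) (μ := volume)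
      (by rw [Tdom_vol]; simp) (fun x _ => hB (t, x))
    simpa [Measure.real, Tdom_vol] using this
  have h2 := norm_setIntegral_le_of_norm_le_const (f := fun t => ∫ x in Tdom, F (t, x))
    (s := Set.Icc (-T) T) (μ := volume) (by simp) (fun t _ => h1 t)
  refine le_trans h2 (le_of_eq ?_)
  rw [Real.volume_real_Icc_of_le (by linarith)]; ring

theorem II_add {F G : QQ → ℝ} (hF : Continuous F) (hG : Continuous G) {T : ℝ}
    (hSF : ∀ q : QQ, T < |q.1| → F q = 0) (hSG : ∀ q : QQ, T < |q.1| → G q = 0) :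
    II (fun q => F q + G q) = II F + II G := by
  unfold II
  rw [← integral_add (inner_int hF hSF) (inner_int hG hSG)]
  refine integral_congr_ae (Filter.Eventually.of_forall fun t => ?_)
  exact integral_add (slice_int hF t) (slice_int hG t)

theorem II_div (G : Fin 3 → P) : II (fun q => (∑ j, Dx j (G j)) q) = 0 := by
  unfold II
  simp only [sum_app, integral_div, integral_zero]

theorem time_slice (f : P) (t : ℝ) (x : Spc) : HasDerivAt (fun s : ℝ => f (s, x)) (Dt f (t, x)) t := by
  have h1 : HasFDerivAt (f : QQ → ℝ) (fderiv ℝ (f : QQ → ℝ) (t, x)) (t, x) :=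
    (f.diffAt (t, x)).hasFDerivAt
  have h2 : HasDerivAt (fun s : ℝ => ((s, x) : QQ)) ((1 : ℝ), (0 : Spc)) t :=
    (hasDerivAt_id t).prodMk (hasDerivAt_const t x)
  exact h1.comp_hasDerivAt t h2

theorem II_Dt (f : P) {T : ℝ} (hf : Supp T f) : II (fun q => Dt f q) = 0 := by
  obtain ⟨B, hB, hb⟩ := bounded_of_supp hf.Dt
  refine integral_eq_zero_of_hasDerivAt_of_integrable (f := fun t : ℝ => ∫ x in Tdom, f (t, x))
    (fun t => ?_) (inner_int (Dt f).cont hf.Dt) (inner_int f.cont hf)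
  have : IsFiniteMeasure (volume.restrict Tdom) := ⟨by simp [Tdom_vol]⟩
  refine (hasDerivAt_integral_of_dominated_loc_of_deriv_le (μ := volume.restrict Tdom)
    (bound := fun _ => B) (F := fun t x => f (t, x)) (F' := fun t x => Dt f (t, x))
    (s := Set.univ) Filter.univ_mem ?_ ?_ ?_ ?_ ?_ ?_).2
  · exact Filter.Eventually.of_forall fun t => (f.cont_slice t).aestronglyMeasurable
  · exact slice_int f.cont t
  · exact ((Dt f).cont_slice t).aestronglyMeasurable
  · exact Filter.Eventually.of_forall fun x t _ => hb _
  · exact integrable_const _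
  · exact Filter.Eventually.of_forall fun x t _ => time_slice f t x

/-- components of test functions -/
theorem exists_test {ψ : ℝ → Spc → ℝ} (h : IsTest ψ) : ∃ (T : ℝ) (f : P), 0 ≤ T ∧ Supp T f ∧
    (∀ t x, pt ψ t x = Dt f (t, x)) ∧ ∀ j t x, pd j (ψ t) x = Dx j f (t, x) := by
  obtain ⟨h1, h2, T, hT⟩ := h
  let f : P := ⟨fun q => ψ q.1 q.2, h1, fun t => h2 t⟩
  refine ⟨max T 0, f, le_max_right _ _, fun q hq => hT q.1 (lt_of_le_of_lt (le_max_left _ _) hq) q.2,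
    fun t x => (time_slice f t x).deriv, fun j t x => ?_⟩
  have := (hasFDerivAt_slice f t x).fderiv
  change fderiv ℝ (fun y => f (t, y)) x (Pi.single j 1) = _
  rw [this]
  simp [Dx, dd_app]

theorem test_comp {φ : ℝ → Spc → Spc} (h : IsTest φ) (l : Fin 3) : IsTest (fun s y => φ s y l) := by
  obtain ⟨h1, h2, T, hT⟩ := h
  refine ⟨?_, fun t x k => ?_, T, fun t ht x => ?_⟩
  · exact (contDiff_pi.1 h1) l
  · simp only [h2 t x k]
  · simp only [hT t ht x]; rfl

theorem limit_exists : ∃ (v : ℕ → Fin 3 → P) (R : ℕ → Fin 3 → Fin 3 → P) (V : Fin 3 → QQ → ℝ) (B : ℝ),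
    (∀ n, Sub 2 (v n) (R n)) ∧ (∀ n i j q, |R n i j q| ≤ (1 / 2) ^ n) ∧
    (∀ n i q, |V i q - v n i q| ≤ (1 / 2) ^ n) ∧ (∀ i, Continuous (V i)) ∧
    (∀ i q, |V i q| ≤ B) ∧ (∀ n i q, |v n i q| ≤ B) ∧ V 0 (0, 0) ≠ 0 ∧
    (∀ i q, 2 < |q.1| → V i q = 0) ∧ ∀ i t, Per (fun x => V i (t, x)) := by
  obtain ⟨v, R, hs, hR, hv, h0⟩ := iteration
  have hd : ∀ i q n, dist (v n i q) (v (n + 1) i q) ≤ 1 / 4 * (1 / 2) ^ n := fun i q n => by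
    rw [dist_comm, Real.dist_eq]
    refine (hv n i q).trans (le_of_eq ?_)
    unfold Kq; ring
  have hlim : ∀ i q, ∃ y, Filter.Tendsto (fun n => v n i q) Filter.atTop (nhds y) := fun i q =>
    cauchySeq_tendsto_of_complete (cauchySeq_of_le_geometric (1 / 2) (1 / 4) (by norm_num) (hd i q))
  choose V hV using hlim
  have hVd : ∀ n i q, |V i q - v n i q| ≤ 1 / 2 * (1 / 2) ^ n := fun n i q => by
    have := dist_le_of_le_geometric_of_tendsto (1 / 2) (1 / 4) (by norm_num) (hd i q) (hV i q) n
    rw [dist_comm, Real.dist_eq] at this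
    refine this.trans (le_of_eq (by ring))
  have hp : ∀ n, (0 : ℝ) < (1 / 2) ^ n := fun n => by positivity
  have hp1 : ∀ n, ((1 : ℝ) / 2) ^ n ≤ 1 := fun n => pow_le_one₀ (by norm_num) (by norm_num)
  obtain ⟨C, hC, hCb⟩ := bounded_fam (v 0) (hs 0).sv
  have hVb : ∀ i q, |V i q| ≤ C + 1 := fun i q => by
    have h1 := hVd 0 i q
    have h2 := hCb i q
    rw [abs_le] at *
    constructor <;> linarith
  refine ⟨v, R, V, C + 2, hs, fun n i j q => ?_, fun n i q => ?_, fun i => ?_, fun i q => ?_,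
    fun n i q => ?_, ?_, fun i q hq => ?_, fun i t x k => ?_⟩
  · refine (hR n i j q).trans ?_
    unfold Kq
    have := hp n
    have := hp1 n
    nlinarith
  · exact (hVd n i q).trans (by linarith [hp n])
  · have hu : TendstoUniformly (fun n q => v n i q) (V i) Filter.atTop := by
      rw [Metric.tendstoUniformly_iff]
      intro ε hε
      have ht : Filter.Tendsto (fun n : ℕ => ((1 : ℝ) / 2) ^ n) Filter.atTop (nhds 0) :=
        tendsto_pow_atTop_nhds_zero_of_lt_one (by norm_num) (by norm_num)
      filter_upwards [ht.eventually (gt_mem_nhds hε)] with n hn q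
      rw [Real.dist_eq]
      exact lt_of_le_of_lt ((hVd n i q).trans (by linarith [hp n])) hn
    exact hu.continuous (Filter.Frequently.of_forall fun n => (v n i).cont)
  · exact (hVb i q).trans (by linarith)
  · have h1 := hVd n i q
    have h2 := hVb i q
    have := hp1 n
    rw [abs_le] at *
    constructor <;> linarith
  · have := hVd 0 0 (0, 0)
    rw [h0] at this
    intro hz
    rw [hz] at this
    norm_num at this
  · refine tendsto_nhds_unique (hV i q) ?_
    have : (fun n => v n i q) = fun _ => 0 := funext fun n => (hs n).sv i q hq
    rw [this]
    exact tendsto_const_nhds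
  · refine tendsto_nhds_unique (hV i _) ?_
    have : (fun n => v n i (t, fun i => x i + (k i : ℝ))) = fun n => v n i (t, x) :=
      funext fun n => (v n i).per t x k
    rw [this]
    exact hV i _

theorem eq_zero_of_geom {x K : ℝ} (h : ∀ n : ℕ, |x| ≤ K * (1 / 2) ^ n) : x = 0 := by
  have ht : Filter.Tendsto (fun n : ℕ => K * ((1 : ℝ) / 2) ^ n) Filter.atTop (nhds (K * 0)) :=
    (tendsto_pow_atTop_nhds_zero_of_lt_one (by norm_num) (by norm_num)).const_mul K
  have := ge_of_tendsto' ht h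
  rw [mul_zero] at this
  exact abs_nonpos_iff.1 this

theorem sum3_le {f : Fin 3 → ℝ} {B : ℝ} (h : ∀ i, |f i| ≤ B) : |∑ i, f i| ≤ 3 * B := by
  refine (Finset.abs_sum_le_sum_abs _ _).trans
    ((Finset.sum_le_card_nsmul _ _ B fun i _ => h i).trans ?_)
  simp

theorem weak_div {v : Fin 3 → P} {T0 : ℝ} {R : Fin 3 → Fin 3 → P} (hs : Sub T0 v R) (f : P) :
    II (fun q => ∑ j, v j q * Dx j f q) = 0 := by
  rw [← II_div (fun j => v j * f)]
  congr 1
  funext q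
  have h : ∑ j, Dx j (v j * f) = ∑ j, v j * Dx j f := by
    have h1 : ∀ j, Dx j (v j * f) = v j * Dx j f + f * Dx j (v j) := fun j => by
      simp [Derivation.leibniz]
    simp only [h1, Finset.sum_add_distrib, ← Finset.mul_sum, hs.div, mul_zero, add_zero]
  rw [h]
  simp

theorem weak_mom {v : Fin 3 → P} {T0 T : ℝ} {R : Fin 3 → Fin 3 → P} (hs : Sub T0 v R)
    (f : Fin 3 → P) (hf : ∀ l, Supp T (f l)) :
    II (fun q => (∑ l, v l q * Dt (f l) q) + ∑ j, ∑ l, v j q * v l q * Dx j (f l) q)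
      = II (fun q => (∑ j, ∑ l, R l j * Dx j (f l)) q) := by
  have lb : ∀ (d : Derivation ℝ P P) (x y : P), d (x * y) = x * d y + y * d x := by
    intro d x y; simp [Derivation.leibniz]
  have key : (∑ l, v l * Dt (f l)) + ∑ j, ∑ l, v j * v l * Dx j (f l)
      = Dt (∑ l, v l * f l) + ((∑ j, Dx j (∑ l, (v l * v j - R l j) * f l))
        + ∑ j, ∑ l, R l j * Dx j (f l)) := by
    have m0 := hs.mom 0
    have m1 := hs.mom 1
    have m2 := hs.mom 2
    simp only [map_sum, Fin.sum_univ_three] at m0 m1 m2 ⊢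
    simp only [lb _ _ (f _), map_add, map_sub] at m0 m1 m2 ⊢
    linear_combination -f 0 * m0 - f 1 * m1 - f 2 * m2
  have s1 : Supp T (∑ l, v l * f l) := Supp.sum fun l => Supp.mul_left _ (hf l)
  have s2 : Supp T (∑ j, Dx j (∑ l, (v l * v j - R l j) * f l)) :=
    Supp.sum fun j => (Supp.sum fun l => Supp.mul_left _ (hf l)).Dx j
  have s3 : Supp T (∑ j, ∑ l, R l j * Dx j (f l)) :=
    Supp.sum fun j => (Supp.sum fun l => Supp.mul_left _ ((hf l).Dx j))
  have e : (fun q => (∑ l, v l q * Dt (f l) q) + ∑ j, ∑ l, v j q * v l q * Dx j (f l) q)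
      = fun q => Dt (∑ l, v l * f l) q + ((∑ j, Dx j (∑ l, (v l * v j - R l j) * f l))
        + ∑ j, ∑ l, R l j * Dx j (f l)) q := by
    funext q
    have := congrArg (fun g : P => g q) key
    simp only [add_app, sum_app, mul_app] at this ⊢
    exact this
  rw [e, II_add (T := T) (Dt _).cont (P.cont _) s1.Dt (s2.add s3), II_Dt _ s1, zero_add]
  have e2 := II_add (T := T) (P.cont (∑ j, Dx j (∑ l, (v l * v j - R l j) * f l)))
    (P.cont (∑ j, ∑ l, R l j * Dx j (f l))) s2 s3
  rw [II_div, zero_add] at e2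
  exact e2

end P

open P in
theorem main_weak (v : ℕ → Fin 3 → P) (R : ℕ → Fin 3 → Fin 3 → P) (V : Fin 3 → QQ → ℝ) (B : ℝ)
    (hs : ∀ n, Sub 2 (v n) (R n)) (hR : ∀ n i j q, |R n i j q| ≤ (1 / 2) ^ n)
    (hV : ∀ n i q, |V i q - v n i q| ≤ (1 / 2) ^ n) (hc : ∀ i, Continuous (V i))
    (hB : ∀ i q, |V i q| ≤ B) (hBn : ∀ n i q, |v n i q| ≤ B) :
    IsWeakEuler (fun t x i => V i (t, x)) (fun _ _ => 0) := by
  have hB0 : 0 ≤ B := (abs_nonneg _).trans (hB 0 (0, 0))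
  have hp : ∀ n, (0 : ℝ) < (1 / 2) ^ n := fun n => by positivity
  constructor
  · intro φ hφ
    choose T f hT hf hft hfx using fun l => exists_test (test_comp hφ l)
    let T0 : ℝ := ∑ l, T l
    have hT0 : 0 ≤ T0 := Finset.sum_nonneg fun l _ => hT l
    have hf0 : ∀ l, Supp T0 (f l) := fun l =>
      (hf l).mono (Finset.single_le_sum (f := T) (fun l _ => hT l) (Finset.mem_univ l))
    obtain ⟨C1, hC1, b1⟩ := bounded_fam (fun l => Dt (f l)) (fun l => (hf0 l).Dt)
    obtain ⟨C2, hC2, b2⟩ := bounded_fam (fun p : Fin 3 × Fin 3 => Dx p.1 (f p.2))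
      (fun p => (hf0 p.2).Dx p.1)
    let F : (Fin 3 → QQ → ℝ) → QQ → ℝ := fun V q =>
      (∑ l, V l q * Dt (f l) q) + ∑ j, ∑ l, V j q * V l q * Dx j (f l) q
    have hFS : ∀ V : Fin 3 → QQ → ℝ, ∀ q : QQ, T0 < |q.1| → F V q = 0 := by
      intro V q hq
      simp only [F]
      have h1 : ∀ l, Dt (f l) q = 0 := fun l => (hf0 l).Dt q hq
      have h2 : ∀ j l, Dx j (f l) q = 0 := fun j l => (hf0 l).Dx j q hq
      simp [h1, h2]
    have hFc : ∀ V : Fin 3 → QQ → ℝ, (∀ i, Continuous (V i)) → Continuous (F V) := by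
      intro V hc
      refine Continuous.add (continuous_finsetSum _ fun l _ => (hc l).mul (Dt (f l)).cont)
        (continuous_finsetSum _ fun j _ => continuous_finsetSum _ fun l _ =>
          ((hc j).mul (hc l)).mul (Dx j (f l)).cont)
    have goal : II (F V) = 0 := by
      refine eq_zero_of_geom (K := (3 * C1 + 9 * (2 * B * C2) + 9 * C2) * (2 * T0)) fun n => ?_
      let W : Fin 3 → QQ → ℝ := fun i q => v n i q
      have hWc : ∀ i, Continuous (W i) := fun i => (v n i).cont
      have hdiff : ∀ q, |F V q - F W q| ≤ (3 * C1 + 9 * (2 * B * C2)) * (1 / 2) ^ n := by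
        intro q
        have e : F V q - F W q = (∑ l, (V l q - W l q) * Dt (f l) q)
            + ∑ j, ∑ l, ((V j q - W j q) * V l q + W j q * (V l q - W l q)) * Dx j (f l) q := by
          simp only [F, Fin.sum_univ_three]; ring
        rw [e]
        have i1 : |∑ l, (V l q - W l q) * Dt (f l) q| ≤ 3 * ((1 / 2) ^ n * C1) :=
          sum3_le fun l => by
            rw [abs_mul]
            exact mul_le_mul (hV n l q) (b1 l q) (abs_nonneg _) (hp n).le
        have i2 : |∑ j, ∑ l, ((V j q - W j q) * V l q + W j q * (V l q - W l q)) * Dx j (f l) q|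
            ≤ 3 * (3 * (((1 / 2) ^ n * B + B * (1 / 2) ^ n) * C2)) :=
          sum3_le fun j => sum3_le fun l => by
            rw [abs_mul]
            refine mul_le_mul ((abs_add_le _ _).trans (add_le_add ?_ ?_)) (b2 (j, l) q) (abs_nonneg _)
              (by have := hp n; positivity)
            · rw [abs_mul]
              exact mul_le_mul (hV n j q) (hB l q) (abs_nonneg _) (hp n).le
            · rw [abs_mul]
              exact mul_le_mul (hBn n j q) (hV n l q) (abs_nonneg _) hB0
        refine (abs_add_le _ _).trans ((add_le_add i1 i2).trans (le_of_eq (by ring)))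
      have hRb : ∀ q, |(∑ j, ∑ l, R n l j * Dx j (f l)) q| ≤ 9 * C2 * (1 / 2) ^ n := by
        intro q
        simp only [sum_app, mul_app]
        have i2 : |∑ j, ∑ l, R n l j q * Dx j (f l) q| ≤ 3 * (3 * ((1 / 2) ^ n * C2)) :=
          sum3_le fun j => sum3_le fun l => by
            rw [abs_mul]
            exact mul_le_mul (hR n l j q) (b2 (j, l) q) (abs_nonneg _) (hp n).le
        exact i2.trans (le_of_eq (by ring))
      have k1 := II_add (F := fun q => F V q - F W q) (G := F W) (T := T0)
        ((hFc V hc).sub (hFc W hWc)) (hFc W hWc)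
        (fun q hq => by simp only [hFS _ q hq, sub_zero]) (hFS W)
      simp only [sub_add_cancel] at k1
      have k2 := weak_mom (hs n) f hf0
      have k3 := II_le hT0 (F := fun q => F V q - F W q)
        (fun q hq => by simp only [hFS _ q hq, sub_zero]) hdiff
      have k4 := II_le hT0 (F := fun q => (∑ j, ∑ l, R n l j * Dx j (f l)) q)
        (Supp.sum fun j => (Supp.sum fun l => Supp.mul_left _ ((hf0 l).Dx j))) hRb
      rw [← k2] at k4
      have k5 : II (F V) = II (fun q => F V q - F W q) + II (F W) := k1
      rw [k5]
      refine (abs_add_le _ _).trans ((add_le_add k3 k4).trans (le_of_eq (by ring)))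
    refine Eq.trans ?_ goal
    unfold II
    simp only [hft, hfx, zero_mul, add_zero, F]
  · intro ψ hψ
    obtain ⟨T, f, hT, hf, -, hfx⟩ := exists_test hψ
    obtain ⟨C2, hC2, b2⟩ := bounded_fam (fun j => Dx j f) (fun j => hf.Dx j)
    let F : (Fin 3 → QQ → ℝ) → QQ → ℝ := fun V q => ∑ j, V j q * Dx j f q
    have hFS : ∀ V : Fin 3 → QQ → ℝ, ∀ q : QQ, T < |q.1| → F V q = 0 := by
      intro V q hq
      simp only [F]
      have h2 : ∀ j, Dx j f q = 0 := fun j => hf.Dx j q hq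
      simp [h2]
    have hFc : ∀ V : Fin 3 → QQ → ℝ, (∀ i, Continuous (V i)) → Continuous (F V) := by
      intro V hc
      exact continuous_finsetSum _ fun l _ => (hc l).mul (Dx l f).cont
    have goal : II (F V) = 0 := by
      refine eq_zero_of_geom (K := 3 * C2 * (2 * T)) fun n => ?_
      let W : Fin 3 → QQ → ℝ := fun i q => v n i q
      have hWc : ∀ i, Continuous (W i) := fun i => (v n i).cont
      have hdiff : ∀ q, |F V q - F W q| ≤ 3 * C2 * (1 / 2) ^ n := by
        intro q
        have e : F V q - F W q = ∑ l, (V l q - W l q) * Dx l f q := by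
          simp only [F, Fin.sum_univ_three]; ring
        rw [e]
        have i1 : |∑ l, (V l q - W l q) * Dx l f q| ≤ 3 * ((1 / 2) ^ n * C2) :=
          sum3_le fun l => by
            rw [abs_mul]
            exact mul_le_mul (hV n l q) (b2 l q) (abs_nonneg _) (hp n).le
        exact i1.trans (le_of_eq (by ring))
      have k1 := II_add (F := fun q => F V q - F W q) (G := F W) (T := T)
        ((hFc V hc).sub (hFc W hWc)) (hFc W hWc)
        (fun q hq => by simp only [hFS _ q hq, sub_zero]) (hFS W)
      simp only [sub_add_cancel] at k1
      have k2 : II (F W) = 0 := weak_div (hs n) f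
      have k3 := II_le hT (F := fun q => F V q - F W q)
        (fun q hq => by simp only [hFS _ q hq, sub_zero]) hdiff
      have k5 : II (F V) = II (fun q => F V q - F W q) + II (F W) := k1
      rw [k5, k2, add_zero]
      exact k3.trans (le_of_eq (by ring))
    refine Eq.trans ?_ goal
    unfold II
    simp only [hfx, F]


/-- There exists a continuous, nontrivial weak solution of the incompressible Euler
equations on ℝ×𝕋³ which vanishes outside a compact time interval. -/
theorem continuous_euler_compact_support :
    ∃ (v : ℝ → Spc → Spc) (p : ℝ → Spc → ℝ),
      (∀ t, Per (v t)) ∧ (∀ t, Per (p t)) ∧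
      IsWeakEuler v p ∧
      Continuous (fun q : ℝ × Spc => v q.1 q.2) ∧
      Continuous (fun q : ℝ × Spc => p q.1 q.2) ∧
      (∃ t x, v t x ≠ 0) ∧
      (∃ a b : ℝ, a ≤ b ∧ ∀ t, t ∉ Set.Icc a b → ∀ x, v t x = 0 ∧ p t x = 0) := by
  obtain ⟨v, R, V, B, hs, hR, hV, hc, hB, hBn, h0, hS, hP⟩ := P.limit_exists
  refine ⟨fun t x i => V i (t, x), fun _ _ => 0, fun t x k => funext fun i => hP i t x k,
    fun t x k => rfl, main_weak v R V B hs hR hV hc hB hBn, continuous_pi hc, continuous_const,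
    ⟨0, 0, fun h => h0 (congrFun h 0)⟩, -2, 2, by norm_num, fun t ht x => ⟨funext fun i => ?_, rfl⟩⟩
  refine hS i (t, x) ?_
  rw [← not_le, abs_le]
  exact ht
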